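/- Let A be a C*-algebra which has stable rank one or real rank zero. Then every element x of Cu(A) satisfies wdiv_{2m}(x) < ∞ for some m ≥ 1 if and only if every element x of Cu(A) satisfies Div_{2m}(x) < ∞ for some m ≥ 1. -/

import Mathlib

/-!
Common definitions: abstract Cuntz semigroups, divisibility, and C*-algebra notions
(nowhere scatteredness, σ-unitality, etc.) used to formalize the statements.
-/

open scoped MultiplierAlgebra ENNReal
open Filter Topology

noncomputable section

universe uu vv

/-- The (sequential) way-below relation `x ≪ y` (compact containment) in a partially
ordered set: whenever an increasing sequence has a supremum lying above `y`, some term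
of the sequence already lies above `x`. -/
def WayBelow {S : Type*} [PartialOrder S] (x y : S) : Prop :=
  ∀ f : ℕ → S, Monotone f → ∀ s : S, IsLUB (Set.range f) s → y ≤ s → ∃ n, x ≤ f n

/-- An abstract Cuntz semigroup (`Cu`-semigroup): a positively ordered abelian monoid in
which every increasing sequence has a supremum, every element is the supremum of a
`≪`-increasing sequence, addition preserves `≪`, and which satisfies the standard
axioms (O5) (almost algebraic order) and (O6) (almost Riesz decomposition), as well as
the existence of infima with idempotents `∞y = sup_n n•y` (all of these hold in the
Cuntz semigroup of any C*-algebra). -/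
class CuSemigroup (S : Type*) extends AddCommMonoid S, PartialOrder S where
  add_le_add' : ∀ a b : S, a ≤ b → ∀ c : S, c + a ≤ c + b
  zero_le' : ∀ x : S, 0 ≤ x
  exists_isLUB : ∀ f : ℕ → S, Monotone f → ∃ s : S, IsLUB (Set.range f) s
  exists_waybelow_seq : ∀ x : S, ∃ f : ℕ → S, Monotone f ∧
    (∀ n, WayBelow (f n) (f (n + 1))) ∧ IsLUB (Set.range f) x
  waybelow_add : ∀ {x y z w : S}, WayBelow x y → WayBelow z w → WayBelow (x + z) (y + w)
  /-- axiom (O5) -/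
  almost_algebraic : ∀ x' x y' y z : S, WayBelow x' x → WayBelow y' y → x + y ≤ z →
    ∃ c : S, y' ≤ c ∧ x' + c ≤ z ∧ z ≤ x + c
  /-- axiom (O6) -/
  almost_riesz : ∀ x' x y z : S, WayBelow x' x → x ≤ y + z →
    ∃ v w : S, v ≤ x ∧ v ≤ y ∧ w ≤ x ∧ w ≤ z ∧ x' ≤ v + w
  /-- `infty y = ∞·y = sup_n n•y` -/
  infty : S → S
  isLUB_infty : ∀ y : S, IsLUB (Set.range fun n : ℕ => n • y) (infty y)
  /-- the infimum `x ⊓ ∞y`, which exists in the Cuntz semigroup of any C*-algebra -/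
  meetInfty : S → S → S
  isGLB_meetInfty : ∀ x y : S, IsGLB {x, infty y} (meetInfty x y)

namespace CuDiv

variable {S : Type*} [CuSemigroup S]

/-- `x` is weakly `(m, n)`-divisible. -/
def IsWeaklyDivisible (m n : ℕ) (x : S) : Prop :=
  ∀ x' : S, WayBelow x' x → ∃ y : Fin n → S, x' ≤ ∑ j, y j ∧ ∀ j, m • y j ≤ x

/-- `x` is `(m, n)`-divisible. -/
def IsDivisible (m n : ℕ) (x : S) : Prop :=
  ∀ x' : S, WayBelow x' x → ∃ y : S, x' ≤ n • y ∧ m • y ≤ x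

/-- `x` is weakly `(m, ω)`-divisible. -/
def IsWeaklyOmegaDivisible (m : ℕ) (x : S) : Prop :=
  ∀ x' : S, WayBelow x' x → ∃ (n : ℕ) (y : Fin n → S), x' ≤ ∑ j, y j ∧ ∀ j, m • y j ≤ x

/-- `x` is `(m, ω)`-divisible. -/
def IsOmegaDivisible (m : ℕ) (x : S) : Prop :=
  ∀ x' : S, WayBelow x' x → ∃ (y : S) (n : ℕ), x' ≤ n • y ∧ m • y ≤ x

/-- `wdiv m x` is the least positive integer `n` such that `x` is weakly
`(m,n)`-divisible, and `∞` if there is no such `n`. -/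
def wdiv (m : ℕ) (x : S) : ℕ∞ :=
  sInf {N : ℕ∞ | ∃ n : ℕ, 1 ≤ n ∧ N = n ∧ IsWeaklyDivisible m n x}

/-- `Div m x` is the least positive integer `n` such that `x` is `(m,n)`-divisible,
and `∞` if there is no such `n`. -/
def Div (m : ℕ) (x : S) : ℕ∞ :=
  sInf {N : ℕ∞ | ∃ n : ℕ, 1 ≤ n ∧ N = n ∧ IsDivisible m n x}

/-- An element `x` is strongly soft if for every `x' ≪ x` there is `t` with
`x' + t ≤ x ≤ ∞t`. -/
def StronglySoft (x : S) : Prop :=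
  ∀ x' : S, WayBelow x' x → ∃ t : S, x' + t ≤ x ∧ x ≤ CuSemigroup.infty t

/-- The Cuntz semigroup characterization of the Global Glimm Property: every element is
`(m, ω)`-divisible for every `m`. -/
def GlobalGlimm (S : Type*) [CuSemigroup S] : Prop :=
  ∀ (m : ℕ) (x : S), IsOmegaDivisible m x

/-- `Cu(A)` is left-soft separative. -/
def LeftSoftSeparative (S : Type*) [CuSemigroup S] : Prop :=
  ∀ x y t : S, StronglySoft x → WayBelow (x + t) (y + t) →
    WayBelow t (CuSemigroup.infty y) → WayBelow t (CuSemigroup.infty x) → WayBelow x y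

/-- `Cu(A)` is weakly cancellative. -/
def WeaklyCancellative (S : Type*) [CuSemigroup S] : Prop :=
  ∀ x y z : S, WayBelow (x + z) (y + z) → WayBelow x y

/-- `Cu(A)` has covering dimension zero. -/
def CoveringDimZero (S : Type*) [CuSemigroup S] : Prop :=
  ∀ x' x y₁ y₂ : S, WayBelow x' x → WayBelow x (y₁ + y₂) →
    ∃ z₁ z₂ : S, z₁ ≤ y₁ ∧ z₂ ≤ y₂ ∧ x' ≤ z₁ + z₂ ∧ z₁ + z₂ ≤ x

end CuDiv

/-- A functional on a Cuntz semigroup: an additive, order preserving map to `ℝ≥0∞`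
preserving suprema of increasing sequences.  (By Elliott–Robert–Santiago, the
functionals on `Cu(A)` are exactly those induced by the lower semicontinuous
2-quasitraces on `A ⊗ K`.) -/
structure CuFunctional (S : Type*) [CuSemigroup S] where
  toFun : S → ℝ≥0∞
  map_zero' : toFun 0 = 0
  map_add' : ∀ x y : S, toFun (x + y) = toFun x + toFun y
  mono' : ∀ x y : S, x ≤ y → toFun x ≤ toFun y
  sup' : ∀ f : ℕ → S, Monotone f → ∀ s : S, IsLUB (Set.range f) s →
    toFun s = ⨆ n, toFun (f n)

instance {S : Type*} [CuSemigroup S] : CoeFun (CuFunctional S) fun _ => S → ℝ≥0∞ :=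
  ⟨CuFunctional.toFun⟩

namespace CuDiv

variable {S : Type*} [CuSemigroup S]

/-- `x <ₛ y` : there is `γ < 1` with `λ(x) ≤ γ·λ(y)` for every functional `λ`. -/
def FunctionalLT (x y : S) : Prop :=
  ∃ γ : ℝ≥0∞, γ < 1 ∧ ∀ lam : CuFunctional S, lam x ≤ γ * lam y

/-- `A` has `k`-comparison (stated on `Cu(A)`). -/
def KComparison (S : Type*) [CuSemigroup S] (k : ℕ) : Prop :=
  ∀ (x : S) (b : Fin (k + 1) → S), (∀ i, FunctionalLT x (b i)) → x ≤ ∑ i, b i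

/-- `A` has strict comparison (stated on `Cu(A)`, via functionals, which correspond to
the lower semicontinuous 2-quasitraces). -/
def StrictComparison (S : Type*) [CuSemigroup S] : Prop :=
  ∀ x y : S, FunctionalLT x y → x ≤ y

/-- The natural topology on the cone `F(Cu(A))` of functionals. -/
def functionalTopology (S : Type*) [CuSemigroup S] : TopologicalSpace (CuFunctional S) :=
  TopologicalSpace.generateFrom
    ({U | ∃ (x : S) (r : ℝ≥0∞), U = {lam : CuFunctional S | r < lam x}} ∪
      {U | ∃ (x' x : S) (r : ℝ≥0∞), WayBelow x' x ∧ U = {lam : CuFunctional S | lam x' < r}})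

/-- A lower semicontinuous affine function on the cone of functionals of `Cu(A)`,
i.e. an element of `L(F(Cu(A)))`. -/
def IsLscAffine (F : CuFunctional S → ℝ≥0∞) : Prop :=
  (letI := functionalTopology S; LowerSemicontinuous F) ∧
    (∀ lam mu nu : CuFunctional S, (∀ x, nu x = lam x + mu x) → F nu = F lam + F mu) ∧
    (∀ (r : ℝ≥0∞) (lam nu : CuFunctional S), (∀ x, nu x = r * lam x) → F nu = r * F lam)

/-- The rank map of `Cu(A)` is surjective: every lower semicontinuous affine function on
the cone of functionals is realized as the rank function `λ ↦ λ(x)` of an element. -/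
def SurjectiveRankMap (S : Type*) [CuSemigroup S] : Prop :=
  ∀ F : CuFunctional S → ℝ≥0∞, IsLscAffine F → ∃ y : S, ∀ lam : CuFunctional S, lam y = F lam

end CuDiv

/-! ### C*-algebra notions -/

section CStar

variable {B : Type*} [NonUnitalCStarAlgebra B]

/-- Positivity in a C*-algebra: `a` is positive iff it is of the form `star b * b`. -/
def CStarNonneg (a : B) : Prop := ∃ b : B, a = star b * b

/-- Cuntz subequivalence `a ≼ b` : `a = lim_n rₙ b rₙ*`. -/
def CuntzBelow (a b : B) : Prop :=
  ∃ r : ℕ → B, Tendsto (fun n => r n * b * star (r n)) atTop (𝓝 a)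

/-- Cuntz equivalence. -/
def CuntzEquiv (a b : B) : Prop := CuntzBelow a b ∧ CuntzBelow b a

/-- `A` is σ-unital: it has a countable (norm-bounded, positive) approximate unit. -/
def SigmaUnital (A : Type*) [NonUnitalCStarAlgebra A] : Prop :=
  ∃ e : ℕ → A, (∀ n, CStarNonneg (e n) ∧ ‖e n‖ ≤ 1) ∧
    ∀ a : A, Tendsto (fun n => e n * a) atTop (𝓝 a) ∧ Tendsto (fun n => a * e n) atTop (𝓝 a)

end CStar

/-- A closed two-sided (automatically star-closed) ideal of a C*-algebra. -/
structure ClosedTwoSidedIdealC (A : Type*) [NonUnitalCStarAlgebra A] where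
  carrier : NonUnitalStarSubalgebra ℂ A
  isClosed : IsClosed (carrier : Set A)
  mul_mem_left : ∀ a : A, ∀ x ∈ carrier, a * x ∈ carrier
  mul_mem_right : ∀ a : A, ∀ x ∈ carrier, x * a ∈ carrier

section Reps

variable {A : Type*} [NonUnitalCStarAlgebra A]
variable {H : Type*} [NormedAddCommGroup H] [InnerProductSpace ℂ H] [CompleteSpace H]

/-- A (topologically) irreducible representation of `A` on a Hilbert space `H`. -/
def IsIrreducibleRep (π : A →⋆ₙₐ[ℂ] (H →L[ℂ] H)) : Prop :=
  (∃ a : A, π a ≠ 0) ∧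
    ∀ K : Submodule ℂ H, IsClosed (K : Set H) → (∀ a : A, ∀ v ∈ K, π a v ∈ K) →
      K = ⊥ ∨ K = ⊤

end Reps

/-- `A` has a nonzero elementary ideal-quotient `J/I`, expressed via a surjection of a
closed two-sided ideal `J` of `A` onto the algebra of compact operators on a Hilbert
space (the kernel `I` of such a `*`-homomorphism is automatically a closed two-sided
ideal of `A`, and conversely any nonzero elementary ideal-quotient arises this way). -/
def HasNonzeroElementaryIdealQuotient (A : Type*) [NonUnitalCStarAlgebra A] : Prop :=
  ∃ (J : ClosedTwoSidedIdealC A) (H : Type) (_ : NormedAddCommGroup H)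
    (_ : InnerProductSpace ℂ H) (_ : CompleteSpace H)
    (ψ : J.carrier →⋆ₙₐ[ℂ] (H →L[ℂ] H)),
      Set.range ψ = {T : H →L[ℂ] H | IsCompactOperator ⇑T} ∧ ∃ x, ψ x ≠ 0

/-- A C*-algebra is nowhere scattered if no ideal-quotient of it is nonzero and
elementary. -/
def NowhereScattered (A : Type*) [NonUnitalCStarAlgebra A] : Prop :=
  ¬ HasNonzeroElementaryIdealQuotient A

/-- A C*-algebra is elementary if it is isomorphic to the algebra of compact operators
on some Hilbert space. -/
def IsElementaryCStar (A : Type*) [NonUnitalCStarAlgebra A] : Prop :=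
  ∃ (H : Type) (_ : NormedAddCommGroup H) (_ : InnerProductSpace ℂ H) (_ : CompleteSpace H)
    (ψ : A →⋆ₙₐ[ℂ] (H →L[ℂ] H)),
      Function.Injective ψ ∧ Set.range ψ = {T : H →L[ℂ] H | IsCompactOperator ⇑T}

/-- A C*-algebra is simple if it is nonzero and has no nontrivial closed two-sided
ideals. -/
def IsSimpleCStar (A : Type*) [NonUnitalCStarAlgebra A] : Prop :=
  (∃ a : A, a ≠ 0) ∧
    ∀ J : ClosedTwoSidedIdealC A, (J.carrier : Set A) = {0} ∨ (J.carrier : Set A) = Set.univ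

/-- Real rank zero: the invertible self-adjoint elements are dense in the self-adjoint
part of the minimal unitization. -/
def RealRankZero (A : Type*) [NonUnitalCStarAlgebra A] : Prop :=
  ∀ x : Unitization ℂ A, IsSelfAdjoint x →
    x ∈ closure {y : Unitization ℂ A | IsSelfAdjoint y ∧ IsUnit y}

/-- Stable rank one: the invertible elements are dense in the minimal unitization. -/
def StableRankOne (A : Type*) [NonUnitalCStarAlgebra A] : Prop :=
  ∀ x : Unitization ℂ A, x ∈ closure {y : Unitization ℂ A | IsUnit y}

section CP

variable {A B : Type*} [NonUnitalCStarAlgebra A] [NonUnitalCStarAlgebra B]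

/-- A linear map between C*-algebras is completely positive if all of its matrix
amplifications preserve positivity. -/
def IsCompletelyPositive (φ : A →ₗ[ℂ] B) : Prop :=
  ∀ (n : ℕ) (a : Matrix (Fin n) (Fin n) A), (∃ b : Matrix (Fin n) (Fin n) A, a = star b * b) →
    ∃ c : Matrix (Fin n) (Fin n) B, a.map ⇑φ = star c * c

/-- A completely positive contractive (c.p.c.) map. -/
def IsCPC (φ : A →ₗ[ℂ] B) : Prop :=
  IsCompletelyPositive φ ∧ ∀ a : A, ‖φ a‖ ≤ ‖a‖

/-- A map between C*-algebras has order zero if it preserves orthogonality of positive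
elements. -/
def IsOrderZero (φ : A →ₗ[ℂ] B) : Prop :=
  ∀ a b : A, CStarNonneg a → CStarNonneg b → a * b = 0 → φ a * φ b = 0

end CP

/-- `A` has nuclear dimension at most `k`: there are c.p.c. approximations of the
identity through finite dimensional C*-algebras in which the downwards maps are sums of
`k+1` c.p.c. order zero maps. -/
def NuclearDimLE (A : Type*) [NonUnitalCStarAlgebra A] (k : ℕ) : Prop :=
  ∀ (F : Finset A) (ε : ℝ), 0 < ε →
    ∃ (Fd : Type) (_ : NonUnitalCStarAlgebra Fd) (_ : FiniteDimensional ℂ Fd)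
      (ψ : A →ₗ[ℂ] Fd) (φ : Fin (k + 1) → (Fd →ₗ[ℂ] A)),
        IsCPC ψ ∧ (∀ i, IsCPC (φ i) ∧ IsOrderZero (φ i)) ∧
        ∀ a ∈ F, ‖(∑ i, φ i (ψ a)) - a‖ ≤ ε

section Prim

variable (A : Type*) [NonUnitalCStarAlgebra A]

/-- A primitive ideal: the kernel of an irreducible representation. -/
def IsPrimitiveIdeal {A : Type*} [NonUnitalCStarAlgebra A] (J : ClosedTwoSidedIdealC A) : Prop :=
  ∃ (H : Type) (_ : NormedAddCommGroup H) (_ : InnerProductSpace ℂ H) (_ : CompleteSpace H)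
    (π : A →⋆ₙₐ[ℂ] (H →L[ℂ] H)),
      IsIrreducibleRep π ∧ ∀ a : A, a ∈ J.carrier ↔ π a = 0

/-- The primitive ideal space of `A`. -/
def PrimIdealSpace := {J : ClosedTwoSidedIdealC A // IsPrimitiveIdeal J}

/-- The hull-kernel (Jacobson) topology on the primitive ideal space. -/
instance : TopologicalSpace (PrimIdealSpace A) :=
  TopologicalSpace.generateFrom {U | ∃ a : A, U = {P : PrimIdealSpace A | a ∉ P.1.carrier}}

/-- `A` has topological dimension zero: the primitive ideal space has a basis of
compact open sets. -/
def TopDimZero : Prop :=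
  ∃ 𝒷 : Set (Set (PrimIdealSpace A)), TopologicalSpace.IsTopologicalBasis 𝒷 ∧
    ∀ U ∈ 𝒷, IsCompact U ∧ IsOpen U

end Prim

section Proj

variable {B : Type*} [NonUnitalCStarAlgebra B]

/-- A projection in a C*-algebra. -/
def IsProjectionElem (p : B) : Prop := IsSelfAdjoint p ∧ p * p = p

/-- `B` contains an infinite projection: a projection which is Murray-von Neumann
equivalent to a proper subprojection of itself. -/
def HasInfiniteProjection (B : Type*) [NonUnitalCStarAlgebra B] : Prop :=
  ∃ p v : B, IsProjectionElem p ∧ star v * v = p ∧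
    p * (v * star v) = v * star v ∧ v * star v ≠ p

end Proj

/-! ### The Cuntz semigroup of a C*-algebra -/

/-- Padding a matrix by one extra row and column of zeros. -/
def matPad {A : Type*} [Zero A] {n : ℕ} (a : Matrix (Fin n) (Fin n) A) :
    Matrix (Fin (n + 1)) (Fin (n + 1)) A :=
  Matrix.of fun i j =>
    if h : (i : ℕ) < n ∧ (j : ℕ) < n then a ⟨i, h.1⟩ ⟨j, h.2⟩ else 0

/-- A witness that `S` is the Cuntz semigroup of the C*-algebra `A`: it provides a
stabilization `stab` of `A` (a model of `A ⊗ K`, described as the C*-completion of the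
union of the matrix algebras `Mₙ(A)`), together with the class map
`cls : (stab)₊ → S = Cu(A)` identifying `S` with the set of Cuntz equivalence classes of
positive elements of `A ⊗ K`, with order induced by Cuntz subequivalence, addition
induced by orthogonal (diagonal) addition, and with the compact containment relation
`≪` given by `x ≪ [a]` iff `x ≤ [(a - ε)₊]` for some `ε > 0`. -/
structure IsCuntzSemigroupOf (A : Type uu) [NonUnitalCStarAlgebra A]
    (S : Type vv) [CuSemigroup S] where
  stab : Type (max uu vv)
  [stabCStar : NonUnitalCStarAlgebra stab]
  matEmb : (n : ℕ) → (Matrix (Fin n) (Fin n) A →⋆ₙₐ[ℂ] stab)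
  matEmb_injective : ∀ n, Function.Injective (matEmb n)
  matEmb_compat : ∀ (n : ℕ) (a : Matrix (Fin n) (Fin n) A), matEmb (n + 1) (matPad a) = matEmb n a
  matEmb_dense : Dense (⋃ n, Set.range (matEmb n))
  cls : stab → S
  cls_zero : cls 0 = 0
  cls_surj : ∀ s : S, ∃ b : stab, CStarNonneg b ∧ cls b = s
  cls_le_iff : ∀ a b : stab, CStarNonneg a → CStarNonneg b → (cls a ≤ cls b ↔ CuntzBelow a b)
  cls_add_orth : ∀ a b : stab, CStarNonneg a → CStarNonneg b → a * b = 0 →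
    cls (a + b) = cls a + cls b
  exists_orth : ∀ a b : stab, CStarNonneg a → CStarNonneg b →
    ∃ a' b' : stab, CStarNonneg a' ∧ CStarNonneg b' ∧ a' * b' = 0 ∧
      cls a' = cls a ∧ cls b' = cls b
  waybelow_iff : ∀ (x : S) (a : stab), CStarNonneg a →
    (WayBelow x (cls a) ↔ ∃ ε : ℝ, 0 < ε ∧ x ≤ cls (cfcₙ (fun t : ℝ => max (t - ε) 0) a))

attribute [instance] IsCuntzSemigroupOf.stabCStar

/-- The Cuntz class `[a] ∈ Cu(A)` of an element `a` of `A` itself (via the canonical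
embedding `A ≅ M₁(A) ⊆ A ⊗ K`). -/
def IsCuntzSemigroupOf.clsA {A : Type*} [NonUnitalCStarAlgebra A] {S : Type*} [CuSemigroup S]
    (h : IsCuntzSemigroupOf A S) (a : A) : S :=
  h.cls (h.matEmb 1 (Matrix.of fun _ _ => a))

/-- `B` has a surjective rank map (every lower semicontinuous affine function on the
cone of functionals on `Cu(B)` is realized as a rank function). -/
def HasSurjectiveRankMap (B : Type*) [NonUnitalCStarAlgebra B] : Prop :=
  ∀ (S : Type) (inst : CuSemigroup S), IsCuntzSemigroupOf B S → CuDiv.SurjectiveRankMap S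

/-- The family of separable sub-C*-algebras of `A` having a surjective rank map. -/
def sepSurjRankFamily (A : Type*) [NonUnitalCStarAlgebra A] :
    Set (NonUnitalStarSubalgebra ℂ A) :=
  {B | ∃ _h : IsClosed (B : Set A),
    TopologicalSpace.SeparableSpace B ∧ HasSurjectiveRankMap B}

/-- The family of separable sub-C*-algebras of `A` with a surjective rank map is
σ-complete (closed under countable increasing unions) and cofinal (every separable
sub-C*-algebra is contained in a member). -/
def SepSurjRankFamilySigmaCompleteCofinal (A : Type*) [NonUnitalCStarAlgebra A] : Prop :=
  (∀ Bseq : ℕ → NonUnitalStarSubalgebra ℂ A, Monotone Bseq →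
    (∀ n, Bseq n ∈ sepSurjRankFamily A) →
      (⨆ n, Bseq n).topologicalClosure ∈ sepSurjRankFamily A) ∧
  (∀ C : NonUnitalStarSubalgebra ℂ A, IsClosed (C : Set A) →
    TopologicalSpace.SeparableSpace C → ∃ B ∈ sepSurjRankFamily A, C ≤ B)

end

section Toolkit

variable {U : Type*} [CStarAlgebra U]

/-- Cuntz subequivalence of elements of a unital C*-algebra, in `ε`-form. -/
def CSub (a b : U) : Prop := ∀ ε : ℝ, 0 < ε → ∃ r : U, ‖r * b * star r - a‖ < ε

/-- The cut-down `(a - ε)₊`. -/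
noncomputable def cut (a : U) (ε : ℝ) : U := cfc (fun t : ℝ => max (t - ε) 0) a

/-- The truncation `min (a / ε) 1`. -/
noncomputable def trunc (a : U) (ε : ℝ) : U := cfc (fun t : ℝ => min (t / ε) 1) a

theorem CSub.of_approx {a b : U}
    (h : ∀ ε : ℝ, 0 < ε → ∃ c : U, ‖c - a‖ ≤ ε ∧ CSub c b) : CSub a b := by
  intro ε hε
  obtain ⟨c, hc, hcb⟩ := h (ε / 2) (by positivity)
  obtain ⟨r, hr⟩ := hcb (ε / 2) (by positivity)
  refine ⟨r, ?_⟩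
  calc ‖r * b * star r - a‖ = ‖(r * b * star r - c) + (c - a)‖ := by congr 1; abel
    _ ≤ _ := norm_add_le _ _
    _ < ε := by linarith

theorem csub_conj (r b : U) : CSub (r * b * star r) b := fun ε hε => ⟨r, by simpa using hε⟩

theorem csub_star_conj (r b : U) : CSub (star r * b * r) b := by
  simpa using csub_conj (star r) b

theorem norm_conj_le (r b : U) : ‖r * b * star r‖ ≤ ‖r‖ * ‖b‖ * ‖r‖ := by
  calc ‖r * b * star r‖ ≤ ‖r * b‖ * ‖star r‖ := norm_mul_le _ _
    _ ≤ ‖r‖ * ‖b‖ * ‖r‖ := by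
      rw [norm_star]; gcongr; exact norm_mul_le _ _

theorem CSub.trans {a b c : U} (hab : CSub a b) (hbc : CSub b c) : CSub a c := by
  refine CSub.of_approx fun ε hε => ?_
  obtain ⟨r, hr⟩ := hab ε hε
  refine ⟨_, hr.le, fun δ hδ => ?_⟩
  obtain ⟨s, hs⟩ := hbc (δ / (‖r‖ * ‖r‖ + 1)) (by positivity)
  refine ⟨r * s, ?_⟩
  have : r * s * c * star (r * s) - r * b * star r = r * (s * c * star s - b) * star r := by
    simp only [star_mul]; noncomm_ring
  rw [this]
  calc _ ≤ ‖r‖ * ‖s * c * star s - b‖ * ‖r‖ := norm_conj_le _ _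
    _ = ‖s * c * star s - b‖ * (‖r‖ * ‖r‖) := by ring
    _ ≤ ‖s * c * star s - b‖ * (‖r‖ * ‖r‖ + 1) := by gcongr; linarith
    _ < δ := by rwa [lt_div_iff₀ (by positivity)] at hs

theorem csub_smul (b : U) {K : ℝ} (hK : 0 ≤ K) : CSub (K • b) b := by
  have := csub_conj (Real.sqrt K • (1 : U)) b
  simpa [smul_smul, Real.mul_self_sqrt hK] using this

variable [PartialOrder U] [StarOrderedRing U]

theorem csub_of_le {a b : U} (ha : 0 ≤ a) (hab : a ≤ b) : CSub a b := by
  have hb : 0 ≤ b := ha.trans hab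
  intro ε hε
  obtain ⟨δ, hδ, hδε⟩ : ∃ δ : ℝ, 0 < δ ∧ δ < ε := ⟨ε / 2, by positivity, by linarith⟩
  set s := CFC.sqrt a
  have hs : s * s = a := CFC.sqrt_mul_sqrt_self a
  have hss : star s = s := (CFC.sqrt_nonneg a).isSelfAdjoint
  obtain ⟨f, hf, hft⟩ : ∃ f : ℝ → ℝ, Continuous f ∧
      ∀ t : ℝ, 0 ≤ t → f t * t * f t = 1 - δ * (f t * f t) := by
    refine ⟨fun t => (Real.sqrt (max t 0 + δ))⁻¹, Continuous.inv₀ (by fun_prop) fun t => ?_,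
      fun t ht0 => ?_⟩
    · have : 0 < max t 0 + δ := by positivity
      positivity
    · have h1 : 0 < t + δ := by positivity
      simp only [max_eq_left ht0]
      field_simp
      rw [Real.sq_sqrt h1.le]
      ring
  set c : U := cfc f b
  have hcs : star c = c := IsSelfAdjoint.cfc
  have hcbc : c * b * c = 1 - δ • (c * c) := by
    have e1 : c * b * c = cfc (fun t : ℝ => f t * t * f t) b := by
      rw [cfc_mul _ _ b (by fun_prop) (by fun_prop), cfc_mul _ _ b (by fun_prop) (by fun_prop),
        cfc_id' ℝ b]
    have e2 : c * c = cfc (fun t : ℝ => f t * f t) b := by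
      rw [cfc_mul _ _ b (by fun_prop) (by fun_prop)]
    rw [e1, e2, ← cfc_const_mul _ _ b (by fun_prop), ← cfc_const_one ℝ b,
      ← cfc_sub _ _ b (by fun_prop) (by fun_prop)]
    exact cfc_congr fun t ht => hft t (spectrum_nonneg_of_nonneg hb ht)
  have hcac : ‖c * a * c‖ ≤ 1 := by
    have h0 : 0 ≤ c * a * c := by simpa [hcs] using star_left_conjugate_nonneg ha c
    rw [CStarAlgebra.norm_le_one_iff_of_nonneg _ h0]
    calc c * a * c ≤ c * b * c := by simpa [hcs] using star_left_conjugate_le_conjugate hab c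
      _ ≤ 1 := by
        rw [hcbc, sub_le_self_iff]
        have := star_mul_self_nonneg c
        rw [hcs] at this
        exact smul_nonneg hδ.le this
  refine ⟨s * c, lt_of_le_of_lt ?_ hδε⟩
  have h1 : s * c * b * star (s * c) - a = - (δ • ((s * c) * star (s * c))) := by
    have : s * c * b * star (s * c) = s * (c * b * c) * s := by
      rw [star_mul, hss, hcs]; noncomm_ring
    rw [this, hcbc, ← hs, star_mul, hss, hcs, mul_sub, sub_mul, mul_smul_comm, smul_mul_assoc]
    noncomm_ring
  rw [h1, norm_neg, norm_smul, CStarRing.norm_self_mul_star, ← CStarRing.norm_star_mul_self,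
    Real.norm_of_nonneg hδ.le, star_mul, hss, hcs, show c * s * (s * c) = c * (s * s) * c by
      noncomm_ring, hs]
  nlinarith

theorem cut_nonneg (a : U) (ε : ℝ) : 0 ≤ cut a ε := cfc_nonneg fun _ _ => le_max_right _ _

theorem cut_isSelfAdjoint (a : U) (ε : ℝ) : star (cut a ε) = cut a ε := IsSelfAdjoint.cfc

theorem trunc_isSelfAdjoint (a : U) (ε : ℝ) : star (trunc a ε) = trunc a ε := IsSelfAdjoint.cfc

theorem trunc_nonneg {a : U} (ha : 0 ≤ a) {ε : ℝ} (hε : 0 < ε) : 0 ≤ trunc a ε :=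
  cfc_nonneg fun t ht => by
    have ht0 : 0 ≤ t := spectrum_nonneg_of_nonneg ha ht
    positivity

theorem trunc_le_one (a : U) (ε : ℝ) : trunc a ε ≤ 1 :=
  cfc_le_one _ _ fun _ _ => min_le_right _ _

theorem cut_le {a : U} (ha : 0 ≤ a) {ε : ℝ} (hε : 0 ≤ ε) : cut a ε ≤ a := by
  conv_rhs => rw [← cfc_id ℝ a]
  refine cfc_mono fun t ht => ?_
  have ht0 : 0 ≤ t := spectrum_nonneg_of_nonneg ha ht
  simpa [ht0] using hε

theorem norm_cut_sub_le {a : U} (ha : 0 ≤ a) {ε : ℝ} (hε : 0 ≤ ε) : ‖cut a ε - a‖ ≤ ε := by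
  have : cut a ε - a = cfc (fun t : ℝ => max (t - ε) 0 - t) a := by
    rw [cfc_sub _ _ a (by fun_prop) (by fun_prop), cfc_id' ℝ a, cut]
  rw [this]
  refine norm_cfc_le hε fun t ht => ?_
  have ht0 : 0 ≤ t := spectrum_nonneg_of_nonneg ha ht
  rw [Real.norm_eq_abs, abs_le]
  constructor
  · linarith [le_max_left (t - ε) 0]
  · rcases max_cases (t - ε) 0 with h | h <;> linarith

theorem trunc_mul_cut {a : U} (ε : ℝ) (hε : 0 < ε) : trunc a ε * cut a ε = cut a ε := by
  rw [trunc, cut, ← cfc_mul _ _ a (by fun_prop) (by fun_prop)]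
  refine cfc_congr fun t _ => ?_
  rcases le_total t ε with h | h
  · simp [h]
  · simp [(one_le_div hε).2 h]

theorem cut_mul_trunc {a : U} (ε : ℝ) (hε : 0 < ε) : cut a ε * trunc a ε = cut a ε := by
  have := congrArg star (trunc_mul_cut (a := a) ε hε)
  rwa [star_mul, cut_isSelfAdjoint, trunc_isSelfAdjoint] at this

theorem trunc_le_smul {a : U} (ha : IsSelfAdjoint a) (ε : ℝ) : trunc a ε ≤ ε⁻¹ • a := by
  conv_rhs => rw [← cfc_id ℝ a]
  rw [← cfc_smul _ _ a (by fun_prop)]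
  refine cfc_mono fun t _ => ?_
  simp [div_eq_inv_mul]

theorem trunc_csub {a : U} (ha : 0 ≤ a) {ε : ℝ} (hε : 0 < ε) : CSub (trunc a ε) a :=
  (csub_of_le (trunc_nonneg ha hε) (trunc_le_smul ha.isSelfAdjoint ε)).trans
    (csub_smul a (by positivity))

theorem cut_csub {a : U} (ha : 0 ≤ a) {ε : ℝ} (hε : 0 ≤ ε) : CSub (cut a ε) a :=
  csub_of_le (cut_nonneg a ε) (cut_le ha hε)

theorem csub_of_forall_cut {a b : U} (ha : 0 ≤ a) (h : ∀ ε : ℝ, 0 < ε → CSub (cut a ε) b) :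
    CSub a b :=
  CSub.of_approx fun ε hε => ⟨cut a ε, norm_cut_sub_le ha hε.le, h ε hε⟩

/-- The truncation is a multiple of the element by something commuting with it. -/
theorem exists_trunc_eq_mul {a : U} (ha : 0 ≤ a) {ε : ℝ} (hε : 0 < ε) :
    ∃ h : U, trunc a ε = a * h ∧ trunc a ε = h * a := by
  obtain ⟨f, hf, key⟩ : ∃ f : ℝ → ℝ, Continuous f ∧
      ∀ t ∈ spectrum ℝ a, min (t / ε) 1 = t * f t := by
    refine ⟨fun t => (max ε t)⁻¹, Continuous.inv₀ (by fun_prop) fun t => (lt_max_of_lt_left hε).ne',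
      fun t ht => ?_⟩
    have ht0 : 0 ≤ t := spectrum_nonneg_of_nonneg ha ht
    rcases le_total t ε with h | h
    · simp only [max_eq_left h, min_eq_left ((div_le_one hε).2 h)]; rfl
    · simp only [max_eq_right h, min_eq_right ((one_le_div hε).2 h),
        mul_inv_cancel₀ (hε.trans_le h).ne']
  refine ⟨cfc f a, ?_, ?_⟩
  · rw [trunc, cfc_congr key, cfc_mul _ _ a (by fun_prop) (by fun_prop), cfc_id' ℝ a]
  · rw [trunc, cfc_congr fun t ht => (key t ht).trans (mul_comm _ _),
      cfc_mul _ _ a (by fun_prop) (by fun_prop), cfc_id' ℝ a]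

theorem mul_trunc_eq_zero {a b : U} (hb : 0 ≤ b) {ε : ℝ} (hε : 0 < ε) (h : a * b = 0) :
    a * trunc b ε = 0 := by
  obtain ⟨k, hk, -⟩ := exists_trunc_eq_mul hb hε
  rw [hk, ← mul_assoc, h, zero_mul]

theorem trunc_mul_eq_zero {a b : U} (ha : 0 ≤ a) {ε : ℝ} (hε : 0 < ε) (h : a * b = 0) :
    trunc a ε * b = 0 := by
  obtain ⟨k, -, hk⟩ := exists_trunc_eq_mul ha hε
  rw [hk, mul_assoc, h, mul_zero]

theorem mul_cut_eq_zero {a b : U} (hb : 0 ≤ b) {ε : ℝ} (hε : 0 < ε) (h : a * b = 0) :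
    a * cut b ε = 0 := by
  rw [← trunc_mul_cut ε hε, ← mul_assoc, mul_trunc_eq_zero hb hε h, zero_mul]

theorem cut_mul_eq_zero {a b : U} (ha : 0 ≤ a) {ε : ℝ} (hε : 0 < ε) (h : a * b = 0) :
    cut a ε * b = 0 := by
  rw [← cut_mul_trunc ε hε, mul_assoc, trunc_mul_eq_zero ha hε h, mul_zero]

theorem cut_cut {a : U} (ha : IsSelfAdjoint a) {δ ε : ℝ} (hε : 0 ≤ ε) :
    cut (cut a δ) ε = cut a (δ + ε) := by
  rw [cut, cut, cut, ← cfc_comp' _ _ a (by fun_prop) (by fun_prop)]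
  refine cfc_congr fun t _ => ?_
  rcases le_total (t - δ) 0 with h | h
  · rw [max_eq_right h, max_eq_right (by linarith), max_eq_right (by linarith)]
  · rw [max_eq_left h, sub_add_eq_sub_sub]

theorem csub_pow {a : U} (ha : 0 ≤ a) (n : ℕ) : CSub a (a ^ (n + 1)) := by
  refine csub_of_forall_cut ha fun ε hε => ?_
  refine CSub.trans (b := (ε ^ n)⁻¹ • a ^ (n + 1)) ?_ (csub_smul _ (by positivity))
  refine csub_of_le (cut_nonneg a ε) ?_
  rw [cut, ← cfc_pow_id (R := ℝ) a, ← cfc_smul _ _ a (by fun_prop)]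
  refine cfc_mono fun t ht => ?_
  have ht0 : 0 ≤ t := spectrum_nonneg_of_nonneg ha ht
  rw [smul_eq_mul]
  refine max_le ?_ (by positivity)
  rcases le_total t ε with h | h
  · exact le_trans (sub_nonpos.2 h) (by positivity)
  · rw [inv_mul_eq_div, le_div_iff₀ (by positivity)]
    calc (t - ε) * ε ^ n ≤ t * t ^ n := by gcongr; linarith
      _ = t ^ (n + 1) := by ring

theorem cut_csub_of_sub_le {a b : U} {ε : ℝ} (ha : IsSelfAdjoint a)
    (h : a - algebraMap ℝ U ε ≤ b) : CSub (cut a ε) b := by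
  have h3 : cut a ε * (a - algebraMap ℝ U ε) * cut a ε = cut a ε ^ 3 := by
    rw [← cfc_const ε a]
    nth_rw 2 [← cfc_id ℝ a]
    rw [cut, ← cfc_pow _ _ a (by fun_prop), ← cfc_sub _ _ a (by fun_prop) (by fun_prop),
      ← cfc_mul _ _ a (by fun_prop) (by fun_prop), ← cfc_mul _ _ a (by fun_prop) (by fun_prop)]
    refine cfc_congr fun t _ => ?_
    simp only [id]
    rcases max_cases (t - ε) 0 with h | h <;> rw [h.1] <;> ring
  have h4 := star_right_conjugate_le_conjugate h (cut a ε)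
  rw [cut_isSelfAdjoint, h3] at h4
  refine (csub_pow (cut_nonneg a ε) 2).trans ((csub_of_le ?_ h4).trans ?_)
  · exact CStarAlgebra.pow_nonneg (cut_nonneg a ε) _
  · simpa [cut_isSelfAdjoint] using csub_conj (cut a ε) b

theorem sub_le_of_norm_sub_le {a b : U} {ε : ℝ} (ha : IsSelfAdjoint a) (hb : IsSelfAdjoint b)
    (h : ‖a - b‖ ≤ ε) : a - algebraMap ℝ U ε ≤ b := by
  have h1 : a - b ≤ algebraMap ℝ U ‖a - b‖ := IsSelfAdjoint.le_algebraMap_norm_self (ha.sub hb)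
  have h2 : algebraMap ℝ U ‖a - b‖ ≤ algebraMap ℝ U ε := algebraMap_mono U h
  have := h1.trans h2
  rw [sub_le_iff_le_add] at this ⊢
  rwa [add_comm]

theorem cut_csub_of_norm_sub_le {a b : U} {ε : ℝ} (ha : IsSelfAdjoint a) (hb : IsSelfAdjoint b)
    (h : ‖a - b‖ ≤ ε) : CSub (cut a ε) b :=
  cut_csub_of_sub_le ha (sub_le_of_norm_sub_le ha hb h)

theorem csub_mul_star (x : U) : CSub (x * star x) (star x * x) := by
  refine (csub_pow (mul_star_self_nonneg x) 1).trans ?_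
  have := csub_conj x (star x * x)
  convert this using 1
  noncomm_ring

theorem csub_star_mul (x : U) : CSub (star x * x) (x * star x) := by
  simpa using csub_mul_star (star x)

theorem mul_csub_self {p : U} (hp : 0 ≤ p) : CSub (p * p) p := by
  have h := csub_conj (CFC.sqrt p) p
  have hs : CFC.sqrt p * CFC.sqrt p = p := CFC.sqrt_mul_sqrt_self p
  rw [(CFC.sqrt_nonneg p).isSelfAdjoint.star_eq] at h
  have e : CFC.sqrt p * p * CFC.sqrt p = p * p := by
    calc CFC.sqrt p * p * CFC.sqrt p
        = CFC.sqrt p * (CFC.sqrt p * CFC.sqrt p) * CFC.sqrt p := by rw [hs]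
      _ = (CFC.sqrt p * CFC.sqrt p) * (CFC.sqrt p * CFC.sqrt p) := by noncomm_ring
      _ = p * p := by rw [hs]
  rwa [e] at h

theorem factor_csub' (x s w : U) :
    CSub (x * s * w * star (x * s * w)) (s * star s) := by
  have h1 : x * s * w * star (x * s * w) = x * (s * (w * star w) * star s) * star x := by
    simp only [star_mul]; noncomm_ring
  rw [h1]
  refine (csub_conj x _).trans ((csub_of_le ?_
    CStarAlgebra.star_right_conjugate_le_norm_smul).trans (csub_smul _ (norm_nonneg _)))
  exact star_right_conjugate_nonneg (mul_star_self_nonneg w) s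

theorem factor_csub {p : U} (hp : 0 ≤ p) (x w : U) :
    CSub (x * p * w * star (x * p * w)) p := by
  refine (factor_csub' x p w).trans ?_
  rw [hp.isSelfAdjoint.star_eq]
  exact mul_csub_self hp

theorem exists_norm_star_mul_sq_mul_sub_lt {a b : U} (hb : 0 ≤ b) (h : CSub a b) {ε : ℝ}
    (hε : 0 < ε) :
    ∃ r : U, ‖star (b * r) * (b * r) - a‖ < ε := by
  obtain ⟨r, hr⟩ := (h.trans (csub_pow hb 1)) ε hε
  refine ⟨star r, ?_⟩
  convert hr using 3
  rw [star_mul, hb.isSelfAdjoint.star_eq, star_star]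
  noncomm_ring

end Toolkit

section Comparison

variable {U : Type*} [CStarAlgebra U] [PartialOrder U] [StarOrderedRing U]

theorem isUnit_of_algebraMap_le {a : U} {κ : ℝ} (hκ : 0 < κ) (h : algebraMap ℝ U κ ≤ a) :
    IsUnit a :=
  CStarAlgebra.isUnit_of_le _ h (isStrictlyPositive_algebraMap hκ)

theorem algebraMap_sub_le_of_norm_le {a b : U} {κ δ : ℝ} (ha : algebraMap ℝ U κ ≤ a)
    (hab : IsSelfAdjoint (a - b)) (h : ‖a - b‖ ≤ δ) : algebraMap ℝ U (κ - δ) ≤ b := by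
  have h1 : a - b ≤ algebraMap ℝ U ‖a - b‖ := IsSelfAdjoint.le_algebraMap_norm_self hab
  have h2 : algebraMap ℝ U ‖a - b‖ ≤ algebraMap ℝ U δ := algebraMap_mono U h
  rw [map_sub, sub_le_iff_le_add]
  calc algebraMap ℝ U κ ≤ a := ha
    _ = b + (a - b) := by abel
    _ ≤ b + algebraMap ℝ U δ := by gcongr; exact h1.trans h2

theorem tendsto_cut {a : U} (ha : 0 ≤ a) : Tendsto (cut a) (𝓝[>] 0) (𝓝 a) := by
  rw [tendsto_iff_norm_sub_tendsto_zero]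
  refine squeeze_zero' (Eventually.of_forall fun _ => norm_nonneg _)
    (eventually_mem_nhdsWithin.mono fun ε hε => norm_cut_sub_le ha (le_of_lt hε)) ?_
  exact tendsto_nhdsWithin_of_tendsto_nhds tendsto_id

theorem csub_of_eventually_cut {a b : U} (ha : 0 ≤ a)
    (h : ∀ᶠ ε in 𝓝[>] (0 : ℝ), CSub (cut a ε) b) : CSub a b := by
  refine CSub.of_approx fun ε hε => ?_
  obtain ⟨δ, hδb, hδ⟩ := (h.and (Metric.tendsto_nhds.1 (tendsto_cut ha) ε hε)).exists
  exact ⟨_, by simpa [dist_eq_norm] using hδ.le, hδb⟩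

theorem cut_add_smul_trunc {a : U} (ha : IsSelfAdjoint a) {ε : ℝ} (hε : 0 < ε) :
    cut a ε + ε • trunc a ε = a := by
  conv_rhs => rw [← cfc_id' ℝ a]
  rw [cut, trunc, ← cfc_const_mul _ _ a (by fun_prop), ← cfc_add a _ _ (by fun_prop) (by fun_prop)]
  refine cfc_congr fun t _ => ?_
  rcases le_total t ε with h | h
  · simp only [max_eq_right (sub_nonpos.2 h), min_eq_left ((div_le_one hε).2 h)]
    field_simp; ring
  · simp only [max_eq_left (sub_nonneg.2 h), min_eq_right ((one_le_div hε).2 h)]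
    ring

theorem smul_trunc_le {a : U} (ha : IsSelfAdjoint a) {ε : ℝ} (hε : 0 < ε) :
    ε • trunc a ε ≤ a := by
  conv_rhs => rw [← cut_add_smul_trunc ha hε]
  exact le_add_of_nonneg_left (cut_nonneg a ε)

theorem mul_eq_zero_symm {a b : U} (ha : 0 ≤ a) (hb : 0 ≤ b) (h : a * b = 0) : b * a = 0 := by
  have := congrArg star h
  rwa [star_mul, ha.isSelfAdjoint.star_eq, hb.isSelfAdjoint.star_eq, star_zero] at this

theorem trunc_mul_trunc_eq_zero {a b : U} (ha : 0 ≤ a) (hb : 0 ≤ b) (h : a * b = 0) {ε δ : ℝ}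
    (hε : 0 < ε) (hδ : 0 < δ) : trunc a ε * trunc b δ = 0 :=
  mul_trunc_eq_zero hb hδ (trunc_mul_eq_zero ha hε h)

theorem trunc_add_trunc_le_one {a b : U} (ha : 0 ≤ a) (hb : 0 ≤ b) (h : a * b = 0) {ε : ℝ}
    (hε : 0 < ε) : trunc a ε + trunc b ε ≤ 1 := by
  have h1 := trunc_mul_trunc_eq_zero ha hb h hε hε
  have h2 := trunc_mul_trunc_eq_zero hb ha (mul_eq_zero_symm ha hb h) hε hε
  have hc : Commute (1 - trunc a ε) (1 - trunc b ε) := by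
    simp only [Commute, SemiconjBy, mul_sub, sub_mul, h1, h2, one_mul, mul_one]
    abel
  have := Commute.mul_nonneg (sub_nonneg.2 (trunc_le_one a ε)) (sub_nonneg.2 (trunc_le_one b ε)) hc
  have e : (1 - trunc a ε) * (1 - trunc b ε) = 1 - (trunc a ε + trunc b ε) := by
    simp only [mul_sub, sub_mul, h1, one_mul, mul_one]
    abel
  rwa [e, sub_nonneg] at this

theorem cut_add_csub {a b : U} (ha : 0 ≤ a) (hb : 0 ≤ b) (h : a * b = 0) {ε : ℝ}
    (hε : 0 < ε) : CSub (cut (a + b) ε) (cut a ε + cut b ε) := by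
  refine cut_csub_of_sub_le (add_nonneg ha hb).isSelfAdjoint ?_
  have h1 : ε • (trunc a ε + trunc b ε) ≤ ε • (1 : U) := 
    smul_le_smul_of_nonneg_left (trunc_add_trunc_le_one ha hb h hε) hε.le
  nth_rw 1 [← cut_add_smul_trunc ha.isSelfAdjoint hε, ← cut_add_smul_trunc hb.isSelfAdjoint hε]
  rw [Algebra.algebraMap_eq_smul_one, sub_le_iff_le_add]
  calc _ = cut a ε + cut b ε + ε • (trunc a ε + trunc b ε) := by rw [smul_add]; abel
    _ ≤ _ := by gcongr

theorem algebraMap_le_add_one_sub_trunc {a b : U} (ha : 0 ≤ a) (hb : 0 ≤ b) (h : a * b = 0) {ε : ℝ}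
    (hε : 0 < ε) (hε1 : ε ≤ 1) :
    algebraMap ℝ U ε ≤ a + b + 1 - trunc a ε - trunc b ε := by
  have h1 : (1 - ε) • (trunc a ε + trunc b ε) ≤ (1 - ε) • (1 : U) :=
    smul_le_smul_of_nonneg_left (trunc_add_trunc_le_one ha hb h hε) (by linarith)
  have h2 := smul_trunc_le ha.isSelfAdjoint hε
  have h3 := smul_trunc_le hb.isSelfAdjoint hε
  rw [Algebra.algebraMap_eq_smul_one]
  have h4 := add_le_add (add_le_add h1 h2) h3
  have h5 : (1 - ε) • (trunc a ε + trunc b ε) + ε • trunc a ε + ε • trunc b ε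
    = trunc a ε + trunc b ε := by module
  rw [h5] at h4
  have h6 : (1 - ε) • (1 : U) + a + b = a + b + 1 - ε • (1 : U) := by module
  rw [h6, le_sub_iff_add_le] at h4
  rw [sub_sub, le_sub_iff_add_le]
  rwa [add_comm]

theorem cut_mul_sub_mul_cut {a : U} (ha : IsSelfAdjoint a) (ε : ℝ) :
    cut a ε * (a - algebraMap ℝ U ε) * cut a ε = cut a ε ^ 3 := by
  rw [← cfc_const ε a]
  nth_rw 2 [← cfc_id ℝ a]
  rw [cut, ← cfc_pow _ _ a (by fun_prop), ← cfc_sub _ _ a (by fun_prop) (by fun_prop),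
    ← cfc_mul _ _ a (by fun_prop) (by fun_prop), ← cfc_mul _ _ a (by fun_prop) (by fun_prop)]
  refine cfc_congr fun t _ => ?_
  simp only [id]
  rcases max_cases (t - ε) 0 with h | h <;> rw [h.1] <;> ring

theorem cut_add_cut_csub {a b c : U} (ha : 0 ≤ a) (hb : 0 ≤ b) (h : a * b = 0) {ε : ℝ}
    (hε : 0 < ε) (hc : a + b - algebraMap ℝ U ε ≤ c) : CSub (cut a ε + cut b ε) c := by
  have h' := mul_eq_zero_symm ha hb h
  have e1 : cut a ε * b = 0 := cut_mul_eq_zero ha hε h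
  have e2 : cut b ε * a = 0 := cut_mul_eq_zero hb hε h'
  have e3 : cut a ε * cut b ε = 0 := mul_cut_eq_zero hb hε e1
  have e4 : cut b ε * cut a ε = 0 := mul_cut_eq_zero ha hε e2
  have e5 : a * cut b ε = 0 := mul_cut_eq_zero hb hε h
  have e6 : b * cut a ε = 0 := mul_cut_eq_zero ha hε h'
  have ka := cut_mul_sub_mul_cut ha.isSelfAdjoint ε
  have kb := cut_mul_sub_mul_cut hb.isSelfAdjoint ε
  set f := cut a ε
  set g := cut b ε
  have hfg : 0 ≤ f + g := add_nonneg (cut_nonneg a ε) (cut_nonneg b ε)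
  have e : (f + g) * (a + b - algebraMap ℝ U ε) * (f + g) = (f + g) ^ 3 := by
    have l1 : (f + g) * (a + b - algebraMap ℝ U ε) * (f + g)
        = f * (a - algebraMap ℝ U ε) * f + g * (b - algebraMap ℝ U ε) * g := by
      have hf : f * algebraMap ℝ U ε * g = 0 := by
        rw [← Algebra.commutes, mul_assoc, e3, mul_zero]
      have hg : g * algebraMap ℝ U ε * f = 0 := by
        rw [← Algebra.commutes, mul_assoc, e4, mul_zero]
      have : f * a * g = 0 := by rw [mul_assoc, e5, mul_zero]
      have : g * b * f = 0 := by rw [mul_assoc, e6, mul_zero]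
      simp only [mul_add, add_mul, mul_sub, sub_mul, *]
      simp
    have l2 : (f + g) ^ 3 = f ^ 3 + g ^ 3 := by
      simp only [pow_succ, pow_zero, mul_add, add_mul, one_mul, mul_assoc, e3, e4, mul_zero]
      simp
    rw [l1, l2, ka, kb]
  have h4 := star_right_conjugate_le_conjugate hc (f + g)
  rw [hfg.isSelfAdjoint.star_eq, e] at h4
  refine (csub_pow hfg 2).trans ((csub_of_le (CStarAlgebra.pow_nonneg hfg _) h4).trans ?_)
  simpa only [hfg.isSelfAdjoint.star_eq] using csub_conj (f + g) c

theorem CSub.add {a b a' b' : U} (ha' : 0 ≤ a') (hb' : 0 ≤ b')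
    (h : a' * b' = 0) (h1 : CSub a a') (h2 : CSub b b') : CSub (a + b) (a' + b') := by
  refine CSub.of_approx fun ε hε => ?_
  have sa : star a' = a' := ha'.isSelfAdjoint.star_eq
  have sb : star b' = b' := hb'.isSelfAdjoint.star_eq
  have h' := mul_eq_zero_symm ha' hb' h
  obtain ⟨r, hr⟩ := exists_norm_star_mul_sq_mul_sub_lt (CStarAlgebra.pow_nonneg ha' 2)
    (h1.trans (csub_pow ha' 1)) (ε := ε / 2) (by positivity)
  obtain ⟨s, hs⟩ := exists_norm_star_mul_sq_mul_sub_lt (CStarAlgebra.pow_nonneg hb' 2)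
    (h2.trans (csub_pow hb' 1)) (ε := ε / 2) (by positivity)
  set x := a' ^ 2 * r + b' ^ 2 * s with hx
  have e1 : star x * x = star (a' ^ 2 * r) * (a' ^ 2 * r) + star (b' ^ 2 * s) * (b' ^ 2 * s) := by
    have l1 : star (a' ^ 2 * r) * (b' ^ 2 * s) = star r * a' * (a' * b') * b' * s := by
      rw [star_mul, star_pow, sa]; noncomm_ring
    have l2 : star (b' ^ 2 * s) * (a' ^ 2 * r) = star s * b' * (b' * a') * a' * r := by
      rw [star_mul, star_pow, sb]; noncomm_ring
    rw [hx, star_add, add_mul, mul_add, mul_add, l1, l2, h, h']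
    simp
  have e2 : x = 1 * (a' + b') * (a' * r + b' * s) := by
    have : 1 * (a' + b') * (a' * r + b' * s) = x + (a' * b') * s + (b' * a') * r := by
      rw [hx]; noncomm_ring
    rw [this, h, h']; simp
  refine ⟨star x * x, ?_, (csub_star_mul x).trans ?_⟩
  · rw [e1]
    calc _ = ‖(star (a' ^ 2 * r) * (a' ^ 2 * r) - a) + (star (b' ^ 2 * s) * (b' ^ 2 * s) - b)‖ := by
          congr 1; abel
      _ ≤ _ := norm_add_le _ _
      _ ≤ ε := by linarith
  · rw [e2]
    exact factor_csub (add_nonneg ha' hb') _ _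

end Comparison

section StableRank

variable {U : Type*} [CStarAlgebra U]

/-- Every element mapped to `1` by the character `F` is a limit of invertible elements. -/
def UnitsDense (F : U →⋆ₐ[ℂ] ℂ) : Prop :=
  ∀ D : U, F D = 1 → ∀ δ : ℝ, 0 < δ → ∃ T : U, IsUnit T ∧ ‖T - D‖ < δ

theorem UnitsDense.exists_mul_eq {F : U →⋆ₐ[ℂ] ℂ} (hd : UnitsDense F) {D L q : U} (hD : F D = 1)
    (hL : L * D * q = q) {ε : ℝ} (hε : 0 < ε) :
    ∃ t t' : U, t * t' = 1 ∧ t * q = D * q ∧ ‖t - D‖ < ε := by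
  obtain ⟨δ, hδ0, hδ1, hδ2⟩ : ∃ δ : ℝ, 0 < δ ∧ δ * ‖L‖ ≤ 1 / 2 ∧
      2 * ‖(1 : U)‖ * (δ * (‖(1 : U)‖ + ‖L‖ * ‖D‖)) < ε := by
    have h1 : Tendsto (fun δ : ℝ => δ * ‖L‖) (𝓝[>] 0) (𝓝 (0 * ‖L‖)) :=
      ((continuous_id.mul continuous_const).tendsto 0).mono_left nhdsWithin_le_nhds
    have h2 : Tendsto (fun δ : ℝ => 2 * ‖(1 : U)‖ * (δ * (‖(1 : U)‖ + ‖L‖ * ‖D‖))) (𝓝[>] 0)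
        (𝓝 (2 * ‖(1 : U)‖ * (0 * (‖(1 : U)‖ + ‖L‖ * ‖D‖)))) :=
      (Continuous.tendsto (by fun_prop) 0).mono_left nhdsWithin_le_nhds
    have h3 := h1.eventually (gt_mem_nhds (show 0 * ‖L‖ < 1 / 2 by simp))
    have h4 := h2.eventually (gt_mem_nhds (show _ < ε by simpa using hε))
    obtain ⟨δ, ⟨h3, h4⟩, h5⟩ := ((h3.and h4).and eventually_mem_nhdsWithin).exists
    exact ⟨δ, h5, h3.le, h4⟩
  obtain ⟨T, ⟨T, rfl⟩, hT⟩ := hd D hD δ hδ0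
  set E := (T : U) - D with hE
  have hEL : ‖E * L‖ ≤ 1 / 2 := (norm_mul_le _ _).trans (le_trans (by gcongr) hδ1)
  obtain ⟨v, hv⟩ : IsUnit (1 + E * L) := by
    have := (Units.oneSub (-(E * L)) (by rw [norm_neg]; linarith)).isUnit
    rwa [Units.val_oneSub, sub_neg_eq_add] at this
  have hvi : (↑v⁻¹ : U) * (1 + E * L) = 1 := by rw [← hv]; exact v.inv_mul
  have hvn : ‖(↑v⁻¹ : U)‖ ≤ 2 * ‖(1 : U)‖ := by
    have h1 : (↑v⁻¹ : U) = 1 - ↑v⁻¹ * (E * L) := by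
      rw [eq_sub_iff_add_eq, ← hvi]; noncomm_ring
    have h2 : ‖(↑v⁻¹ : U)‖ ≤ ‖(1 : U)‖ + ‖(↑v⁻¹ : U)‖ * ‖E * L‖ := by
      conv_lhs => rw [h1]
      exact (norm_sub_le _ _).trans (by gcongr; exact norm_mul_le _ _)
    nlinarith [norm_nonneg (↑v⁻¹ : U)]
  refine ⟨↑v⁻¹ * T, ↑T⁻¹ * v, ?_, ?_, ?_⟩
  · rw [mul_assoc, ← mul_assoc (T : U), T.mul_inv, one_mul, v.inv_mul]
  · have : (T : U) * q = (1 + E * L) * (D * q) := by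
      rw [add_mul, one_mul, mul_assoc E, ← mul_assoc L, hL, hE]; noncomm_ring
    rw [mul_assoc, this, ← mul_assoc, hvi, one_mul]
  · have : ↑v⁻¹ * (T : U) - D = ↑v⁻¹ * (E * (1 - L * D)) := by
      have h1 : D = ↑v⁻¹ * (1 + E * L) * D := by rw [hvi, one_mul]
      conv_lhs => rw [h1]
      rw [hE]; noncomm_ring
    rw [this]
    refine lt_of_le_of_lt ?_ hδ2
    refine (norm_mul_le _ _).trans ?_
    gcongr
    refine (norm_mul_le _ _).trans ?_
    gcongr
    exact (norm_sub_le _ _).trans (by gcongr; exact norm_mul_le _ _)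

variable [PartialOrder U] [StarOrderedRing U]

theorem map_trunc_eq_zero (F : U →⋆ₐ[ℂ] ℂ) {a : U} (ha : 0 ≤ a) (h : F a = 0) {ε : ℝ}
    (hε : 0 < ε) : F (trunc a ε) = 0 := by
  obtain ⟨k, hk, -⟩ := exists_trunc_eq_mul ha hε
  rw [hk, map_mul, h, zero_mul]

theorem map_cut_eq_zero (F : U →⋆ₐ[ℂ] ℂ) {a : U} (ha : 0 ≤ a) (h : F a = 0) {ε : ℝ}
    (hε : 0 < ε) : F (cut a ε) = 0 := by
  rw [← trunc_mul_cut ε hε, map_mul, map_trunc_eq_zero F ha h hε, zero_mul]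

/-- The bump `trunc (cut a δ) δ` acts as a unit on `cut a (2 * δ)`. -/
theorem bump_mul_cut {a : U} (ha : 0 ≤ a) {δ : ℝ} (hδ : 0 < δ) :
    trunc (cut a δ) δ * cut a (2 * δ) = cut a (2 * δ) := by
  rw [two_mul, ← cut_cut ha.isSelfAdjoint hδ.le]
  exact trunc_mul_cut δ hδ

theorem cut_mul_bump {a : U} (ha : 0 ≤ a) {δ : ℝ} (hδ : 0 < δ) :
    cut a (2 * δ) * trunc (cut a δ) δ = cut a (2 * δ) := by
  rw [two_mul, ← cut_cut ha.isSelfAdjoint hδ.le]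
  exact cut_mul_trunc δ hδ

theorem bump_mul_trunc (a : U) {δ : ℝ} (hδ : 0 < δ) :
    trunc (cut a δ) δ * trunc a δ = trunc (cut a δ) δ := by
  obtain ⟨k, -, hk⟩ := exists_trunc_eq_mul (cut_nonneg a δ) hδ
  rw [hk, mul_assoc, cut_mul_trunc δ hδ]

theorem exists_algebraMap_le_add_bump {c : U} (hc : 0 ≤ c) {δ : ℝ} (hδ : 0 < δ) :
    ∃ κ : ℝ, 0 < κ ∧
      algebraMap ℝ U κ ≤ c + (1 - trunc (cut c δ) δ) * (1 - trunc (cut c δ) δ) := by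
  refine ⟨min δ 1, by positivity, ?_⟩
  have e : trunc (cut c δ) δ = cfc (fun t : ℝ => min (max (t - δ) 0 / δ) 1) c := by
    rw [trunc, cut, ← cfc_comp' _ _ c (by fun_prop) (by fun_prop)]
  have e1 : 1 - trunc (cut c δ) δ = cfc (fun t : ℝ => 1 - min (max (t - δ) 0 / δ) 1) c := by
    rw [cfc_sub _ _ c (by fun_prop) (by fun_prop), e, cfc_const_one ℝ c]
  have e2 : c + (1 - trunc (cut c δ) δ) * (1 - trunc (cut c δ) δ) = cfc (fun t : ℝ =>
      t + (1 - min (max (t - δ) 0 / δ) 1) * (1 - min (max (t - δ) 0 / δ) 1)) c := by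
    rw [cfc_add c _ _ (by fun_prop) (by fun_prop), cfc_id' ℝ c, e1,
      cfc_mul _ _ c (by fun_prop) (by fun_prop)]
  rw [e2]
  refine algebraMap_le_cfc _ _ c (fun t ht => ?_) (by fun_prop)
  have ht0 : 0 ≤ t := spectrum_nonneg_of_nonneg hc ht
  rcases le_total t δ with h | h
  · rw [max_eq_right (sub_nonpos.2 h)]
    simp
    right; exact ht0
  · have := mul_self_nonneg (1 - min (max (t - δ) 0 / δ) 1)
    exact (min_le_left _ _).trans (by linarith)

/-- For `ξ` with `ξ* ξ` close to `a + b`, `a` and `b` orthogonal, there is a right inverse of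
`ξ*` on the cut-downs of `a` and of `b`, and `ξ* ξ` is bounded below there. -/
theorem exists_rightInverse {a b ξ : U} (ha : 0 ≤ a) (hb : 0 ≤ b) (hab : a * b = 0) {η : ℝ}
    (hη : 0 < η) (hη1 : η ≤ 1) (hξ : ‖star ξ * ξ - (a + b)‖ < η / 2) :
    ∃ m : U, cut a η * star ξ * (ξ * m) = cut a η ∧ cut b η * star ξ * (ξ * m) = cut b η ∧
      CSub (cut a η) (cut a η * star ξ * star (cut a η * star ξ)) := by
  have hba := mul_eq_zero_symm ha hb hab
  set M := star ξ * ξ + 1 - trunc a η - trunc b η with hM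
  have hMle : algebraMap ℝ U (η - η / 2) ≤ M := by
    have hsub : a + b + 1 - trunc a η - trunc b η - M = a + b - star ξ * ξ := by
      rw [hM]; abel
    refine algebraMap_sub_le_of_norm_le (algebraMap_le_add_one_sub_trunc ha hb hab hη hη1) ?_ ?_
    · rw [hsub]
      exact (add_nonneg ha hb).isSelfAdjoint.sub (IsSelfAdjoint.star_mul_self ξ)
    · rw [hsub, norm_sub_rev]; exact hξ.le
  obtain ⟨v, hv⟩ := isUnit_of_algebraMap_le (by linarith) hMle
  have ka : cut a η * M = cut a η * star ξ * ξ := by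
    have h1 := cut_mul_trunc (a := a) η hη
    have h2 : cut a η * trunc b η = 0 := mul_trunc_eq_zero hb hη (cut_mul_eq_zero ha hη hab)
    rw [hM, mul_sub, mul_sub, mul_add, h1, h2]; noncomm_ring
  have kb : cut b η * M = cut b η * star ξ * ξ := by
    have h1 := cut_mul_trunc (a := b) η hη
    have h2 : cut b η * trunc a η = 0 := mul_trunc_eq_zero ha hη (cut_mul_eq_zero hb hη hba)
    rw [hM, mul_sub, mul_sub, mul_add, h1, h2]; noncomm_ring
  refine ⟨↑v⁻¹, ?_, ?_, ?_⟩
  · rw [← mul_assoc, ← ka, ← hv, mul_assoc, v.mul_inv, mul_one]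
  · rw [← mul_assoc, ← kb, ← hv, mul_assoc, v.mul_inv, mul_one]
  · have h1 : cut a η * star ξ * star (cut a η * star ξ) = cut a η * M * cut a η := by
      rw [ka, star_mul, star_star, cut_isSelfAdjoint]; noncomm_ring
    have h2 := star_right_conjugate_le_conjugate hMle (cut a η)
    rw [cut_isSelfAdjoint] at h2
    have h3 : cut a η ^ 2 = (η / 2)⁻¹ • (cut a η * algebraMap ℝ U (η - η / 2) * cut a η) := by
      rw [Algebra.algebraMap_eq_smul_one, mul_smul_comm, smul_mul_assoc, smul_smul, mul_one, sq]
      rw [show (η / 2)⁻¹ * (η - η / 2) = 1 by field_simp; ring, one_smul]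
    rw [h1]
    refine (csub_pow (cut_nonneg a η) 1).trans ?_
    rw [h3]
    refine (csub_smul _ (by positivity)).trans (csub_of_le ?_ h2)
    have : 0 ≤ algebraMap ℝ U (η - η / 2) := algebraMap_nonneg U (by linarith)
    simpa [cut_isSelfAdjoint] using star_right_conjugate_nonneg this (cut a η)

/-- Cancellation of Cuntz subequivalence. -/
theorem UnitsDense.csub_cancel {F : U →⋆ₐ[ℂ] ℂ} (hd : UnitsDense F) {a b c c₀ : U} (ha : 0 ≤ a)
    (hb : 0 ≤ b) (hc : 0 ≤ c) (hc₀ : 0 ≤ c₀) (Fb : F b = 0) (Fc : F c = 0) (hbc : b * c = 0)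
    (hac : a * c₀ = 0) (hcc : CSub c c₀) {δ : ℝ} (hδ : 0 < δ)
    (h : CSub (a + c₀) (cut b (2 * δ) + cut c (2 * δ))) : CSub a b := by
  have hcb := mul_eq_zero_symm hb hc hbc
  obtain ⟨κ, hκ, hκc⟩ := exists_algebraMap_le_add_bump hc hδ
  obtain ⟨ρ, hρ⟩ := exists_norm_star_mul_sq_mul_sub_lt hc₀ hcc hκ
  refine csub_of_eventually_cut ha ?_
  have hev : ∀ᶠ η in 𝓝[>] (0 : ℝ), ‖star (cut c₀ η * ρ) * (cut c₀ η * ρ) - c‖ < κ := by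
    have : Tendsto (fun η => ‖star (cut c₀ η * ρ) * (cut c₀ η * ρ) - c‖) (𝓝[>] (0 : ℝ))
        (𝓝 ‖star (c₀ * ρ) * (c₀ * ρ) - c‖) := by
      have h1 := (tendsto_cut hc₀).mul_const ρ
      exact ((h1.star.mul h1).sub_const c).norm
    exact this.eventually (gt_mem_nhds hρ)
  have hev1 : ∀ᶠ η in 𝓝[>] (0 : ℝ), η ≤ 1 :=
    (tendsto_nhdsWithin_of_tendsto_nhds tendsto_id).eventually (ge_mem_nhds one_pos)
  filter_upwards [hev, hev1, eventually_mem_nhdsWithin] with η hη hη1 hη0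
  replace hη0 : 0 < η := hη0
  set m := cut b (2 * δ) + cut c (2 * δ) with hm
  have hm0 : 0 ≤ m := add_nonneg (cut_nonneg _ _) (cut_nonneg _ _)
  obtain ⟨r, hr⟩ := exists_norm_star_mul_sq_mul_sub_lt hm0 h (ε := η / 2) (by positivity)
  obtain ⟨Mi, hMa, hMc, hMl⟩ := exists_rightInverse ha hc₀ hac hη0 hη1 hr
  have hφ : cut a η * cut c₀ η = 0 := mul_cut_eq_zero hc₀ hη0 (cut_mul_eq_zero ha hη0 hac)
  set φ := cut a η
  set φc := cut c₀ η with hφc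
  have sφc : star φc = φc := cut_isSelfAdjoint _ _
  set ξ := m * r with hξ
  set gb := trunc (cut b δ) δ with hgb
  set gc := trunc (cut c δ) δ with hgc
  set g' := trunc b δ with hg'
  have hg0 : 0 ≤ g' := trunc_nonneg hb hδ
  have gbb : gb * cut b (2 * δ) = cut b (2 * δ) := bump_mul_cut hb hδ
  have gcc : gc * cut c (2 * δ) = cut c (2 * δ) := bump_mul_cut hc hδ
  have cutbc : cut b δ * cut c δ = 0 := mul_cut_eq_zero hc hδ (cut_mul_eq_zero hb hδ hbc)
  have cutcb : cut c δ * cut b δ = 0 := mul_cut_eq_zero hb hδ (cut_mul_eq_zero hc hδ hcb)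
  have gbgc : gb * gc = 0 := trunc_mul_trunc_eq_zero (cut_nonneg _ _) (cut_nonneg _ _) cutbc hδ hδ
  have gcgb : gc * gb = 0 := trunc_mul_trunc_eq_zero (cut_nonneg _ _) (cut_nonneg _ _) cutcb hδ hδ
  have gbc : gb * cut c (2 * δ) = 0 := by rw [← gcc, ← mul_assoc, gbgc, zero_mul]
  have gcb : gc * cut b (2 * δ) = 0 := by rw [← gbb, ← mul_assoc, gcgb, zero_mul]
  have gg' : gb * g' = gb := bump_mul_trunc b hδ
  set o := 1 - gb - gc with ho
  have om : o * m = 0 := by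
    rw [ho, hm, sub_mul, sub_mul, mul_add, mul_add, mul_add, gbb, gcc, gbc, gcb]; simp
  have so : star o = o := by
    rw [ho, star_sub, star_sub, star_one, hgb, hgc, trunc_isSelfAdjoint, trunc_isSelfAdjoint]
  have mo : m * o = 0 := by
    have := congrArg star om
    rwa [star_mul, so, hm0.isSelfAdjoint.star_eq, star_zero] at this
  have oξ : o * ξ = 0 := by rw [hξ, ← mul_assoc, om, zero_mul]
  have ξo : star ξ * o = 0 := by
    rw [hξ, star_mul, hm0.isSelfAdjoint.star_eq, mul_assoc, mo, mul_zero]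
  set V := ξ * Mi * (φc * ρ) with hV
  set W := star (φc * ρ) * star ξ with hW
  have oV : o * V = 0 := by rw [hV, mul_assoc ξ, ← mul_assoc, oξ, zero_mul]
  have Wo : W * o = 0 := by rw [hW, mul_assoc, ξo, mul_zero]
  have WV : W * V = star (φc * ρ) * (φc * ρ) := by
    calc W * V = star ρ * (φc * star ξ * (ξ * Mi)) * (φc * ρ) := by
          rw [hW, hV, star_mul, sφc]; noncomm_ring
      _ = _ := by rw [hMc, star_mul, sφc]
  set D := V + o with hD
  set q := 1 - g' with hq
  set N := star (φc * ρ) * (φc * ρ) + (1 - gc) * (1 - gc) with hN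
  have FD : F D = 1 := by
    have Fm : F m = 0 := by
      rw [hm, map_add, map_cut_eq_zero F hb Fb (by positivity),
        map_cut_eq_zero F hc Fc (by positivity), add_zero]
    have Fgb : F gb = 0 :=
      map_trunc_eq_zero F (cut_nonneg _ _) (map_cut_eq_zero F hb Fb hδ) hδ
    have Fgc : F gc = 0 :=
      map_trunc_eq_zero F (cut_nonneg _ _) (map_cut_eq_zero F hc Fc hδ) hδ
    rw [hD, hV, hξ, ho]
    simp [Fm, Fgb, Fgc]
  have hNle : algebraMap ℝ U (κ - ‖star (φc * ρ) * (φc * ρ) - c‖) ≤ N := by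
    have e : c + (1 - gc) * (1 - gc) - N = c - star (φc * ρ) * (φc * ρ) := by rw [hN]; abel
    refine algebraMap_sub_le_of_norm_le hκc ?_ ?_
    · rw [e]; exact hc.isSelfAdjoint.sub (IsSelfAdjoint.star_mul_self _)
    · rw [e, norm_sub_rev]
  obtain ⟨v, hv⟩ := isUnit_of_algebraMap_le (by linarith) hNle
  have hLD : (↑v⁻¹ * (W + o)) * D * q = q := by
    have gbq : gb * q = 0 := by rw [hq, mul_sub, mul_one, gg', sub_self]
    have oo : o * o * q = (1 - gc) * (1 - gc) * q := by
      have e : o * o = (1 - gc) * (1 - gc) + gb * gc + gc * gb + (gb - 1 - 1) * gb := by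
        rw [ho]; noncomm_ring
      rw [e, gbgc, gcgb, add_zero, add_zero, add_mul, mul_assoc (gb - 1 - 1), gbq, mul_zero,
        add_zero]
    have e : (W + o) * D * q = N * q := by
      have : (W + o) * D * q = W * V * q + W * o * q + o * V * q + o * o * q := by
        rw [hD]; noncomm_ring
      rw [this, WV, Wo, oV, oo, hN, add_mul, zero_mul, add_zero, add_zero]
    rw [mul_assoc (↑v⁻¹ : U), mul_assoc (↑v⁻¹ : U), e, ← hv, ← mul_assoc, v.inv_mul, one_mul]
  obtain ⟨t, t', htt, htq, -⟩ := hd.exists_mul_eq FD hLD one_pos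
  have aD : φ * star ξ * D = 0 := by
    have : φ * star ξ * D = φ * star ξ * (ξ * Mi) * (φc * ρ) + φ * (star ξ * o) := by
      rw [hD, hV]; noncomm_ring
    rw [this, hMa, ξo, ← mul_assoc, hφ]; simp
  have key : φ * star ξ = φ * star ξ * t * g' * t' := by
    have h1 : φ * star ξ * t * q = 0 := by rw [mul_assoc, htq, ← mul_assoc, aD, zero_mul]
    have h2 : φ * star ξ * t * g' = φ * star ξ * t := by
      rw [hq, mul_sub, mul_one, sub_eq_zero] at h1
      exact h1.symm
    rw [h2, mul_assoc _ t, htt, mul_one]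
  refine hMl.trans ?_
  rw [key]
  exact (factor_csub hg0 _ _).trans (trunc_csub hb hδ)

/-- Riesz interpolation of Cuntz subequivalence. -/
theorem UnitsDense.exists_interpolant {F : U →⋆ₐ[ℂ] ℂ} (hd : UnitsDense F) {a₁ a₂ c e : U}
    (ha₁ : 0 ≤ a₁) (ha₂ : 0 ≤ a₂) (hc : 0 ≤ c) (he : 0 ≤ e) (Fc : F c = 0) (Fe : F e = 0)
    {δ : ℝ} (hδ : 0 < δ) (h₁c : CSub a₁ (cut c (2 * δ))) (h₂c : CSub a₂ (cut c (2 * δ)))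
    (h₁e : CSub a₁ e) (h₂e : CSub a₂ e) {η : ℝ} (hη : 0 < η) (hη1 : η ≤ 1) :
    ∃ s : U, F s = 0 ∧ CSub (cut a₁ η) (s * star s) ∧ CSub (cut (a₂ ^ 4) η) (s * star s) ∧
      CSub (s * star s) e ∧ CSub (s * star s) c := by
  set c' := cut c (2 * δ) with hc'
  have hc'0 : 0 ≤ c' := cut_nonneg _ _
  have sc' : star c' = c' := hc'0.isSelfAdjoint.star_eq
  have Fc' : F c' = 0 := map_cut_eq_zero F hc Fc (by positivity)
  set c₁ := trunc (cut c δ) δ with hc₁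
  set c₃ := trunc c δ with hc₃
  have c'c₁ : c' * c₁ = c' := cut_mul_bump hc hδ
  have c₁c₃ : c₁ * c₃ = c₁ := bump_mul_trunc c hδ
  have c'c₃ : c' * c₃ = c' := by rw [← c'c₁, mul_assoc, c₁c₃]
  have Fc₁ : F c₁ = 0 := map_trunc_eq_zero F (cut_nonneg _ _) (map_cut_eq_zero F hc Fc hδ) hδ
  -- the choices for `a₁`
  obtain ⟨r, hr⟩ := exists_norm_star_mul_sq_mul_sub_lt hc'0 h₁c (ε := η / 2) (by positivity)
  obtain ⟨r', hr'⟩ := exists_norm_star_mul_sq_mul_sub_lt he h₁e (ε := η / 2) (by positivity)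
  obtain ⟨m, hm, -, hml⟩ := exists_rightInverse ha₁ le_rfl (mul_zero a₁) hη hη1
    (by simpa only [add_zero] using hr)
  obtain ⟨m', hm', -, -⟩ := exists_rightInverse ha₁ le_rfl (mul_zero a₁) hη hη1
    (by simpa only [add_zero] using hr')
  set φ := cut a₁ η
  set α := c' * r with hα
  set β := e * r' with hβ
  have αc₁ : star α * c₁ = star α := by rw [hα, star_mul, sc', mul_assoc, c'c₁]
  have αc₃ : star α * c₃ = star α := by rw [hα, star_mul, sc', mul_assoc, c'c₃]
  -- the choices for `a₂`
  obtain ⟨ζ, hζ, hζ'⟩ : ∃ ζ : ℝ, 0 < ζ ∧ ∀ x y : U, ‖x - a₂‖ < ζ → ‖y - a₂‖ < ζ →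
      ‖x * y * star (x * y) - a₂ ^ 4‖ < η := by
    have hcont : Continuous fun p : U × U => ‖p.1 * p.2 * star (p.1 * p.2) - a₂ ^ 4‖ := by
      fun_prop
    have h0 : ‖a₂ * a₂ * star (a₂ * a₂) - a₂ ^ 4‖ < η := by
      rw [star_mul, ha₂.isSelfAdjoint.star_eq, show a₂ * a₂ * (a₂ * a₂) = a₂ ^ 4 by noncomm_ring,
        sub_self, norm_zero]
      exact hη
    obtain ⟨ζ, hζ, h⟩ := Metric.eventually_nhds_iff.1
      ((hcont.tendsto (a₂, a₂)).eventually (gt_mem_nhds h0))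
    refine ⟨ζ, hζ, fun x y hx hy => h (y := (x, y)) ?_⟩
    rw [Prod.dist_eq]
    exact max_lt (by simpa [dist_eq_norm] using hx) (by simpa [dist_eq_norm] using hy)
  obtain ⟨r₂, hr₂⟩ := exists_norm_star_mul_sq_mul_sub_lt hc'0 h₂c hζ
  obtain ⟨r₂', hr₂'⟩ := exists_norm_star_mul_sq_mul_sub_lt he h₂e hζ
  set α₂ := c' * r₂ with hα₂
  set β₂ := e * r₂' with hβ₂
  have α₂c₁ : star α₂ * c₁ = star α₂ := by rw [hα₂, star_mul, sc', mul_assoc, c'c₁]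
  set s₂ := β₂ * star α₂ with hs₂
  have s₂c₁ : s₂ * c₁ = s₂ := by rw [hs₂, mul_assoc, α₂c₁]
  set γ := α * m with hγ
  set γ' := β * m' with hγ'
  set d := γ * star β * s₂ with hd'
  have dc₁ : d * c₁ = d := by rw [hd', mul_assoc, s₂c₁]
  have dc₃ : d * c₃ = d := by rw [← dc₁, mul_assoc, c₁c₃]
  set D := d + 1 - c₁ with hD
  set q := 1 - c₃ with hq
  have FD : F D = 1 := by
    have : F d = 0 := by
      rw [hd', hγ, hα]; simp [Fc']
    rw [hD]; simp [this, Fc₁]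
  have Dq : D * q = q := by
    have : D * q = (d - d * c₃) + q - (c₁ - c₁ * c₃) := by rw [hD, hq]; noncomm_ring
    rw [this, dc₃, c₁c₃]; simp
  have hcont : ∃ ε₁ : ℝ, 0 < ε₁ ∧ ∀ k : U, ‖k‖ < ε₁ →
      ‖star β₂ * (s₂ + γ' * star α * k) * α₂ * star (star β₂ * (s₂ + γ' * star α * k) * α₂)
        - a₂ ^ 4‖ < η := by
    have hcont : Continuous fun k : U => ‖star β₂ * (s₂ + γ' * star α * k) * α₂ *
        star (star β₂ * (s₂ + γ' * star α * k) * α₂) - a₂ ^ 4‖ := by fun_prop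
    have h0 : ‖star β₂ * (s₂ + γ' * star α * 0) * α₂ *
        star (star β₂ * (s₂ + γ' * star α * 0) * α₂) - a₂ ^ 4‖ < η := by
      have := hζ' _ _ hr₂' hr₂
      rwa [show star β₂ * (s₂ + γ' * star α * 0) * α₂ = star β₂ * β₂ * (star α₂ * α₂) by
        rw [hs₂]; noncomm_ring]
    obtain ⟨ε₁, hε₁, h⟩ := Metric.eventually_nhds_iff.1
      ((hcont.tendsto 0).eventually (gt_mem_nhds h0))
    exact ⟨ε₁, hε₁, fun k hk => h (by simpa [dist_eq_norm] using hk)⟩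
  obtain ⟨ε₁, hε₁, hT⟩ := hcont
  obtain ⟨t, t', htt, htq, htD⟩ := hd.exists_mul_eq (L := 1) FD (by rw [one_mul, Dq]) hε₁
  rw [Dq] at htq
  specialize hT _ htD
  have hk : star α * (t - D) = star α * (t * c₃ - d) := by
    have h1 : t * c₃ = t - q := by
      rw [eq_sub_iff_add_eq, ← htq, ← mul_add, hq]; simp
    have : star α * (t * c₃ - d) = star α * (t - D) + (star α * c₃ - star α * c₁) := by
      rw [h1, hD, hq]; noncomm_ring
    rw [this, αc₁, αc₃, sub_self, add_zero]
  set s := s₂ + γ' * star α * (t - D) with hs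
  have seS : s = 1 * e * (r₂' * star α₂ + r' * m' * star α * (t - D)) := by
    rw [hs, hs₂, hγ', hβ₂, hβ]; noncomm_ring
  set S' := s₂ + γ' * star α * (t - d) with hS'
  have sc₃ : s = S' * c₃ := by
    have h1 : s = s₂ + γ' * (star α * (t * c₃ - d)) := by rw [hs, ← hk]; noncomm_ring
    have h2 : s₂ * c₃ = s₂ := by rw [← s₂c₁, mul_assoc, c₁c₃]
    have h3 : S' * c₃ = s₂ * c₃ + γ' * (star α * (t * c₃ - d * c₃)) := by
      rw [hS']; noncomm_ring
    rw [h1, h3, h2, dc₃]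
  have key : φ * star α = φ * star β * s * t' := by
    have αq : star α * q = 0 := by rw [hq, mul_sub, mul_one, αc₃, sub_self]
    have h1 : φ * star β * s = φ * star α * (t - q) := by
      have h2 : φ * star β * s = φ * star β * s₂ + φ * star β * γ' * (star α * (t - D)) := by
        rw [hs]; noncomm_ring
      have h3 : φ * (star α * (t - D)) = φ * star α * (t - q) - φ * star α * γ * star β * s₂
          + φ * (star α * c₁ - star α * c₃) := by
        rw [hD, hd', hq]; noncomm_ring
      rw [h2, hm', h3, αc₁, αc₃, hm]; simp
    rw [h1, mul_sub, mul_assoc φ _ q, αq, mul_zero, sub_zero, mul_assoc, htt, mul_one]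
  refine ⟨s, ?_, ?_, ?_, ?_, ?_⟩
  · rw [seS]; simp [Fe]
  · refine hml.trans ?_
    rw [key]
    exact factor_csub' _ _ _
  · refine CSub.trans (cut_csub_of_norm_sub_le ?_ (IsSelfAdjoint.mul_star_self _) ?_)
      (factor_csub' (star β₂) s α₂)
    · exact (CStarAlgebra.pow_nonneg ha₂ 4).isSelfAdjoint
    · rw [norm_sub_rev]; exact hT.le
  · rw [seS]; exact factor_csub he _ _
  · refine (csub_mul_star s).trans ?_
    have h1 : star s * s = 1 * c₃ * star S' * star (1 * c₃ * star S') := by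
      have : star c₃ = c₃ := trunc_isSelfAdjoint _ _
      rw [sc₃, one_mul, star_mul, star_mul, star_star, this]
    rw [h1]
    exact (factor_csub (trunc_nonneg hc hδ) _ _).trans (trunc_csub hc hδ)

end StableRank

section Order

variable {S : Type*} [CuSemigroup S]

instance CuSemigroup.isOrderedAddMonoid : IsOrderedAddMonoid S where
  add_le_add_left a b h c := by
    rw [add_comm a c, add_comm b c]
    exact CuSemigroup.add_le_add' a b h c

theorem WayBelow.mono {x x' y y' : S} (h : WayBelow x' y) (hx : x ≤ x') (hy : y ≤ y') :
    WayBelow x y' := fun f hf s hs hle =>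
  let ⟨n, hn⟩ := h f hf s hs (hy.trans hle)
  ⟨n, hx.trans hn⟩

theorem WayBelow.le {x y : S} (h : WayBelow x y) : x ≤ y := by
  obtain ⟨f, hf, -, hs⟩ := CuSemigroup.exists_waybelow_seq y
  obtain ⟨n, hn⟩ := h f hf y hs le_rfl
  exact hn.trans (hs.1 ⟨n, rfl⟩)

theorem WayBelow.zero (y : S) : WayBelow 0 y := fun _ _ _ _ _ => ⟨0, CuSemigroup.zero_le' _⟩

theorem WayBelow.exists_between {x y : S} (h : WayBelow x y) :
    ∃ z, WayBelow x z ∧ WayBelow z y := by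
  obtain ⟨f, hf, hw, hs⟩ := CuSemigroup.exists_waybelow_seq y
  obtain ⟨n, hn⟩ := h f hf y hs le_rfl
  exact ⟨f (n + 1), (hw n).mono hn le_rfl, (hw (n + 1)).mono le_rfl (hs.1 ⟨n + 2, rfl⟩)⟩

theorem WayBelow.directed {x₁ x₂ y : S} (h₁ : WayBelow x₁ y) (h₂ : WayBelow x₂ y) :
    ∃ z, x₁ ≤ z ∧ x₂ ≤ z ∧ WayBelow z y := by
  obtain ⟨f, hf, hw, hs⟩ := CuSemigroup.exists_waybelow_seq y
  obtain ⟨n₁, hn₁⟩ := h₁ f hf y hs le_rfl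
  obtain ⟨n₂, hn₂⟩ := h₂ f hf y hs le_rfl
  exact ⟨f (max n₁ n₂), hn₁.trans (hf (le_max_left _ _)), hn₂.trans (hf (le_max_right _ _)),
    (hw _).mono le_rfl (hs.1 ⟨_, rfl⟩)⟩

theorem exists_almost_complement {x' x z : S} (h : WayBelow x' x) (hz : x ≤ z) :
    ∃ c, x' + c ≤ z ∧ z ≤ x + c := by
  obtain ⟨c, -, h₁, h₂⟩ := CuSemigroup.almost_algebraic x' x 0 0 z h (.zero 0) (by rwa [add_zero])
  exact ⟨c, h₁, h₂⟩

variable (S) in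
/-- Addition is continuous with respect to the way-below relation. -/
def AddContinuous : Prop :=
  ∀ u y z : S, WayBelow u (y + z) → ∃ y' z', WayBelow y' y ∧ WayBelow z' z ∧ u ≤ y' + z'

variable (S) in
/-- Cancellation of compactly contained summands. -/
def AlmostCancellative : Prop := ∀ x y z : S, WayBelow (x + z) (y + z) → x ≤ y

variable (S) in
/-- Almost interpolation between pairs of elements. -/
def AlmostInterpolation : Prop :=
  ∀ x₁' x₁ x₂' x₂ c e : S, WayBelow x₁' x₁ → WayBelow x₂' x₂ → x₁ ≤ c → x₁ ≤ e → x₂ ≤ c →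
    x₂ ≤ e → ∃ z, x₁' ≤ z ∧ x₂' ≤ z ∧ z ≤ c ∧ z ≤ e

variable (S) in
/-- The compact elements are dense. -/
def CompactsDense : Prop :=
  ∀ x' x : S, WayBelow x' x → ∃ p, WayBelow p p ∧ x' ≤ p ∧ p ≤ x

variable (S) in
/-- Twice an element below `p + e` is, up to `p + p`, twice an element below `e`. -/
def HalvesRemainders : Prop :=
  ∀ y' y p e : S, WayBelow y' y → y + y ≤ p + e → ∃ q, q + q ≤ e ∧ y' ≤ p + p + q

theorem AddContinuous.finset_sum (hS : AddContinuous S) {ι : Type*} (s : Finset ι) (y : ι → S) :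
    ∀ u : S, WayBelow u (∑ i ∈ s, y i) →
      ∃ y' : ι → S, (∀ i, WayBelow (y' i) (y i)) ∧ u ≤ ∑ i ∈ s, y' i := by
  classical
  induction s using Finset.induction_on with
  | empty => exact fun u hu => ⟨fun _ => 0, fun i => .zero _, by simpa using hu.le⟩
  | insert a s ha ih =>
    intro u hu
    rw [Finset.sum_insert ha] at hu
    obtain ⟨v, w, hv, hw, huv⟩ := hS _ _ _ hu
    obtain ⟨y', hy', hwy⟩ := ih w hw
    refine ⟨Function.update y' a v, fun i => ?_, ?_⟩
    · by_cases hi : i = a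
      · subst hi; simpa using hv
      · simpa [hi] using hy' i
    · rw [Finset.sum_insert ha, Function.update_self]
      refine huv.trans (add_le_add le_rfl (hwy.trans (Finset.sum_le_sum fun i hi => ?_)))
      rw [Function.update_of_ne (ne_of_mem_of_not_mem hi ha)]

theorem AddContinuous.nsmul (hS : AddContinuous S) {k : ℕ} {u w : S} (h : WayBelow u (k • w)) :
    ∃ w', WayBelow w' w ∧ u ≤ k • w' := by
  induction k generalizing u with
  | zero => exact ⟨0, .zero _, by simpa using h.le⟩
  | succ k ih =>
    rw [succ_nsmul] at h
    obtain ⟨a, b, ha, hb, hu⟩ := hS _ _ _ h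
    obtain ⟨w₁, hw₁, h₁⟩ := ih ha
    obtain ⟨w', h₁', h₂', hw'⟩ := hw₁.directed hb
    refine ⟨w', hw', hu.trans ?_⟩
    rw [succ_nsmul]
    exact add_le_add (h₁.trans (nsmul_le_nsmul_right h₁' k)) h₂'

theorem AddContinuous.nsmul_finset (hS : AddContinuous S) {ι : Type*} (s : Finset ι) {k : ℕ}
    {u : ι → S} {w : S} (h : ∀ i ∈ s, WayBelow (u i) (k • w)) :
    ∃ w', WayBelow w' w ∧ ∀ i ∈ s, u i ≤ k • w' := by
  classical
  induction s using Finset.induction_on with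
  | empty => exact ⟨0, .zero _, by simp⟩
  | insert a s ha ih =>
    obtain ⟨w₁, hw₁, h₁⟩ := ih fun i hi => h i (Finset.mem_insert_of_mem hi)
    obtain ⟨w₂, hw₂, h₂⟩ := hS.nsmul (h a (Finset.mem_insert_self _ _))
    obtain ⟨w', h₁', h₂', hw'⟩ := hw₁.directed hw₂
    refine ⟨w', hw', fun i hi => ?_⟩
    rcases Finset.mem_insert.1 hi with rfl | hi
    · exact h₂.trans (nsmul_le_nsmul_right h₂' k)
    · exact (h₁ i hi).trans (nsmul_le_nsmul_right h₁' k)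

theorem isDivisible_two_of_forall (hS : AddContinuous S) {k n : ℕ} {x : S}
    (hk : ∀ y' y : Fin n → S, (∀ i, WayBelow (y' i) (y i)) → (∀ i, y i + y i ≤ x) →
      ∃ w, w + w ≤ x ∧ ∀ i, y' i ≤ k • w)
    (hx : CuDiv.IsWeaklyDivisible 2 n x) : CuDiv.IsDivisible 2 (n * k) x := by
  intro x' hx'
  obtain ⟨x'', h₁, h₂⟩ := hx'.exists_between
  obtain ⟨y, hy, hyx⟩ := hx x'' h₂
  obtain ⟨y', hy', hxy⟩ := hS.finset_sum Finset.univ y x' (h₁.mono le_rfl hy)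
  obtain ⟨w, hw, hyw⟩ := hk y' y hy' fun i => by simpa [two_nsmul] using hyx i
  refine ⟨w, hxy.trans ?_, by rwa [two_nsmul]⟩
  refine (Finset.sum_le_card_nsmul _ _ _ fun i _ => hyw i).trans ?_
  rw [Finset.card_univ, Fintype.card_fin, mul_nsmul']

section Cancellative

theorem AlmostCancellative.le (hc : AlmostCancellative S) {u' u w' w v : S} (hu : WayBelow u' u)
    (hw : WayBelow w' w) (h : u + w ≤ v + w') : u' ≤ v :=
  hc u' v w' ((CuSemigroup.waybelow_add hu hw).mono le_rfl h)

theorem exists_add_le_of_double_le (hS : AddContinuous S) (hc : AlmostCancellative S)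
    (hI : AlmostInterpolation S)
    {x y₁' y₁ y₂' y₂ : S} (h₁ : WayBelow y₁' y₁)
    (h₂ : WayBelow y₂' y₂) (hx₁ : y₁ + y₁ ≤ x) (hx₂ : y₂ + y₂ ≤ x) :
    ∃ z, z ≤ y₂ ∧ y₂' ≤ z + z ∧ y₁' + z ≤ x := by
  have le_self : ∀ a b : S, a ≤ a + b := fun a b =>
    le_add_of_nonneg_right (CuSemigroup.zero_le' b)
  obtain ⟨a₂, h₁a, ha₂⟩ := h₁.exists_between
  obtain ⟨a, h₁a, haa₂⟩ := h₁a.exists_between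
  obtain ⟨m, hm, hxm⟩ := exists_almost_complement h₁a
    (haa₂.le.trans (ha₂.le.trans ((le_self _ _).trans hx₁)))
  have ham : a₂ ≤ m := hc.le ha₂ (haa₂.mono le_rfl ha₂.le)
    (hx₁.trans (by rwa [add_comm m a]))
  obtain ⟨t, h₂t, ht⟩ := h₂.exists_between
  obtain ⟨v, w, hv₂, hva, hw₂, hwm, htvw⟩ := CuSemigroup.almost_riesz t y₂ a m ht
    ((le_self _ _).trans (hx₂.trans hxm))
  obtain ⟨v', w', hv', hw', hvw⟩ := hS _ _ _ (h₂t.mono le_rfl htvw)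
  obtain ⟨z, hvz, hwz, hzm, hz₂⟩ := hI v' v w' w m y₂ hv' hw' (hva.trans (haa₂.le.trans ham)) hv₂
    hwm hw₂
  exact ⟨z, hz₂, hvw.trans (add_le_add hvz hwz), (add_le_add le_rfl hzm).trans hm⟩

theorem exists_double_le_of_add_le (hc : AlmostCancellative S)
    (hI : AlmostInterpolation S)
    {x y' y z' z : S} (hy : WayBelow y' y) (hz : WayBelow z' z)
    (hxy : y + y ≤ x) (hxz : z + z ≤ x) (hyz : y + z ≤ x) :
    ∃ w, w + w ≤ x ∧ y' ≤ w ∧ z' ≤ w := by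
  have le_self : ∀ a b : S, a ≤ a + b := fun a b =>
    le_add_of_nonneg_right (CuSemigroup.zero_le' b)
  have chain : ∀ {u' u : S}, WayBelow u' u → ∃ a b c d, WayBelow u' a ∧ WayBelow a b ∧
      WayBelow b c ∧ WayBelow c d ∧ WayBelow d u := fun h => by
    obtain ⟨d, h, hd⟩ := h.exists_between
    obtain ⟨c, h, hc⟩ := h.exists_between
    obtain ⟨b, h, hb⟩ := h.exists_between
    obtain ⟨a, h, ha⟩ := h.exists_between
    exact ⟨a, b, c, d, h, ha, hb, hc, hd⟩
  obtain ⟨ya, yb, yc, yd, hy', hya, hyb, hyc, hyd⟩ := chain hy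
  obtain ⟨za, zb, zc, zd, hz', hza, hzb, hzc, hzd⟩ := chain hz
  have hyx : y ≤ x := (le_self _ _).trans hxy
  have hzx : z ≤ x := (le_self _ _).trans hxz
  obtain ⟨e₁, he₁, hxe₁⟩ := exists_almost_complement hyc (hyd.le.trans hyx)
  obtain ⟨e₂, he₂, hxe₂⟩ := exists_almost_complement hzc (hzd.le.trans hzx)
  rw [add_comm yd] at hxe₁
  rw [add_comm zd] at hxe₂
  have hye₁ : yd ≤ e₁ := hc.le hyd hyd (hxy.trans hxe₁)
  have hze₁ : zd ≤ e₁ := hc.le hzd hyd ((add_comm z y ▸ hyz).trans hxe₁)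
  have hye₂ : yd ≤ e₂ := hc.le hyd hzd (hyz.trans hxe₂)
  have hze₂ : zd ≤ e₂ := hc.le hzd hzd (hxz.trans hxe₂)
  obtain ⟨c, hyc', hzc', hce₁, hce₂⟩ := hI yc yd zc zd e₁ e₂ hyc hzc hye₁ hye₂ hze₁ hze₂
  have hyac : WayBelow yb c := hyb.mono le_rfl hyc'
  have hzac : WayBelow zb c := hzb.mono le_rfl hzc'
  obtain ⟨c₁, hyc₁, hzc₁, hc₁⟩ := hyac.directed hzac
  obtain ⟨c₂, hc₁₂, hc₂⟩ := hc₁.exists_between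
  have hcx : yc + c ≤ x := (add_le_add le_rfl hce₁).trans he₁
  have hcx' : zc + c ≤ x := (add_le_add le_rfl hce₂).trans he₂
  have hc₂x : c₂ ≤ x := hc₂.le.trans (hce₁.trans ((le_add_of_nonneg_left
    (CuSemigroup.zero_le' yc)).trans he₁))
  obtain ⟨g, hg, hxg⟩ := exists_almost_complement hc₁₂ hc₂x
  rw [add_comm c₂] at hxg
  have hyg : yb ≤ g := hc.le hyb hc₂ (hcx.trans hxg)
  have hzg : zb ≤ g := hc.le hzb hc₂ (hcx'.trans hxg)
  obtain ⟨w, hyw, hzw, hwc, hwg⟩ := hI ya yb za zb c₁ g hya hza hyc₁ hyg hzc₁ hzg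
  exact ⟨w, (add_le_add hwc hwg).trans hg, hy'.le.trans hyw, hz'.le.trans hzw⟩

theorem exists_double_le_of_double_le (hS : AddContinuous S) (hc : AlmostCancellative S)
    (hI : AlmostInterpolation S)
    {x y₁' y₁ y₂' y₂ : S} (h₁ : WayBelow y₁' y₁)
    (h₂ : WayBelow y₂' y₂) (hx₁ : y₁ + y₁ ≤ x) (hx₂ : y₂ + y₂ ≤ x) :
    ∃ w, w + w ≤ x ∧ y₁' ≤ w ∧ y₂' ≤ 2 • w := by
  obtain ⟨a, h₁a, ha⟩ := h₁.exists_between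
  obtain ⟨t, h₂t, ht⟩ := h₂.exists_between
  obtain ⟨z, hz₂, htz, haz⟩ := exists_add_le_of_double_le hS hc hI ha ht hx₁ hx₂
  rw [← two_nsmul] at htz
  obtain ⟨z', hz', hy₂⟩ := hS.nsmul (h₂t.mono le_rfl htz)
  obtain ⟨w, hw, h₁w, hzw⟩ := exists_double_le_of_add_le hc hI h₁a hz'
    ((add_le_add ha.le ha.le).trans hx₁) ((add_le_add hz₂ hz₂).trans hx₂) haz
  exact ⟨w, hw, h₁w, hy₂.trans (nsmul_le_nsmul_right hzw 2)⟩

theorem exists_double_le_of_forall_double_le (hS : AddContinuous S) (hc : AlmostCancellative S)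
    (hI : AlmostInterpolation S)
    {ι : Type*} (s : Finset ι) {x : S} {y : ι → S}
    (hx : ∀ i, y i + y i ≤ x) : ∀ y' : ι → S, (∀ i, WayBelow (y' i) (y i)) →
      ∃ w, w + w ≤ x ∧ ∀ i ∈ s, y' i ≤ 2 • w := by
  classical
  induction s using Finset.induction_on with
  | empty => exact fun y' _ => ⟨0, by simpa using CuSemigroup.zero_le' x, by simp⟩
  | insert a s ha ih =>
    intro y' hy'
    choose t hyt ht using fun i => (hy' i).exists_between
    obtain ⟨w, hw, htw⟩ := ih t ht
    obtain ⟨w', hw', hyw'⟩ := hS.nsmul_finset s fun i hi => (hyt i).mono le_rfl (htw i hi)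
    obtain ⟨v, hv, hwv, hav⟩ := exists_double_le_of_double_le hS hc hI hw' (hy' a) hw (hx a)
    refine ⟨v, hv, fun i hi => ?_⟩
    rcases Finset.mem_insert.1 hi with rfl | hi
    · exact hav
    · exact (hyw' i hi).trans (nsmul_le_nsmul_right hwv 2)

end Cancellative

section Compact

theorem exists_compact_double_le (hS : AddContinuous S) (hc : CompactsDense S)
    (hK : HalvesRemainders S)
    {x z y' y : S} (hz : WayBelow z z) (hy : WayBelow y' y)
    (hxz : z + z ≤ x) (hxy : y + y ≤ x) :
    ∃ w, WayBelow w w ∧ w + w ≤ x ∧ z ≤ w ∧ y' ≤ 4 • w := by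
  obtain ⟨c, h₁, h₂⟩ := exists_almost_complement (CuSemigroup.waybelow_add hz hz) hxz
  obtain ⟨t, hyt, ht⟩ := hy.exists_between
  obtain ⟨q, hq, htq⟩ := hK t y (z + z) c ht (hxy.trans h₂)
  have h0 : (0 : S) ≤ q := CuSemigroup.zero_le' q
  have hzw : z ≤ z + q := le_add_of_nonneg_right h0
  have htw : t ≤ 4 • (z + q) := by
    refine htq.trans ?_
    rw [nsmul_add, show z + z + (z + z) = 4 • z by abel]
    refine add_le_add le_rfl ?_
    calc q = 1 • q := (one_nsmul q).symm
      _ ≤ 4 • q := nsmul_le_nsmul_left h0 (by norm_num)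
  obtain ⟨w₁, hw₁, hyw₁⟩ := hS.nsmul (hyt.mono le_rfl htw)
  obtain ⟨w₂, hzw₂, hw₁₂, hw₂⟩ := (hz.mono le_rfl hzw).directed hw₁
  obtain ⟨p, hp, hwp, hpw⟩ := hc _ _ hw₂
  refine ⟨p, hp, ?_, hzw₂.trans hwp, hyw₁.trans (nsmul_le_nsmul_right (hw₁₂.trans hwp) 4)⟩
  calc p + p ≤ z + q + (z + q) := add_le_add hpw hpw
    _ = z + z + (q + q) := by abel
    _ ≤ z + z + c := add_le_add le_rfl hq
    _ ≤ x := h₁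

theorem exists_compact_double_le_of_forall (hS : AddContinuous S) (hc : CompactsDense S)
    (hK : HalvesRemainders S)
    {ι : Type*} (s : Finset ι) {x : S} {y' y : ι → S}
    (hy : ∀ i, WayBelow (y' i) (y i)) (hx : ∀ i, y i + y i ≤ x) :
    ∃ w, WayBelow w w ∧ w + w ≤ x ∧ ∀ i ∈ s, y' i ≤ 4 • w := by
  classical
  induction s using Finset.induction_on with
  | empty => exact ⟨0, .zero 0, by simpa using CuSemigroup.zero_le' x, by simp⟩
  | insert a s ha ih =>
    obtain ⟨w, hw, hwx, hyw⟩ := ih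
    obtain ⟨v, hv, hvx, hwv, hav⟩ := exists_compact_double_le hS hc hK hw (hy a) hwx (hx a)
    refine ⟨v, hv, hvx, fun i hi => ?_⟩
    rcases Finset.mem_insert.1 hi with rfl | hi
    · exact hav
    · exact (hyw i hi).trans (nsmul_le_nsmul_right hwv 4)

end Compact

theorem exists_isDivisible_two (hS : AddContinuous S)
    (h : (AlmostCancellative S ∧ AlmostInterpolation S) ∨
      (CompactsDense S ∧ HalvesRemainders S)) {n : ℕ} (hn : 1 ≤ n) {x : S}
    (hx : CuDiv.IsWeaklyDivisible 2 n x) : ∃ N, 1 ≤ N ∧ CuDiv.IsDivisible 2 N x := by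
  rcases h with ⟨hc, hI⟩ | ⟨hc, hK⟩
  · refine ⟨n * 2, by omega, isDivisible_two_of_forall hS (fun y' y hy hyx => ?_) hx⟩
    obtain ⟨w, hw, h⟩ := exists_double_le_of_forall_double_le hS hc hI Finset.univ hyx y' hy
    exact ⟨w, hw, fun i => h i (Finset.mem_univ i)⟩
  · refine ⟨n * 4, by omega, isDivisible_two_of_forall hS (fun y' y hy hyx => ?_) hx⟩
    obtain ⟨w, -, hw, h⟩ := exists_compact_double_le_of_forall hS hc hK Finset.univ hy hyx
    exact ⟨w, hw, fun i => h i (Finset.mem_univ i)⟩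

theorem sInf_natCast_lt_top_iff {P : ℕ → Prop} :
    sInf {N : ℕ∞ | ∃ n : ℕ, 1 ≤ n ∧ N = n ∧ P n} < ⊤ ↔ ∃ n, 1 ≤ n ∧ P n := by
  rw [sInf_lt_iff]
  constructor
  · rintro ⟨_, ⟨n, hn, -, h⟩, -⟩
    exact ⟨n, hn, h⟩
  · rintro ⟨n, hn, h⟩
    exact ⟨n, ⟨n, hn, rfl, h⟩, ENat.natCast_lt_top n⟩

theorem wdiv_lt_top_iff_div_lt_top (hS : AddContinuous S)
    (h : (AlmostCancellative S ∧ AlmostInterpolation S) ∨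
      (CompactsDense S ∧ HalvesRemainders S)) :
    (∀ x : S, ∃ m : ℕ, 1 ≤ m ∧ CuDiv.wdiv (2 * m) x < ⊤) ↔
      (∀ x : S, ∃ m : ℕ, 1 ≤ m ∧ CuDiv.Div (2 * m) x < ⊤) := by
  simp only [CuDiv.wdiv, CuDiv.Div, sInf_natCast_lt_top_iff]
  refine ⟨fun hx x => ?_, fun hx x => ?_⟩
  · obtain ⟨m, hm, n, hn, hd⟩ := hx x
    refine ⟨1, le_rfl, exists_isDivisible_two hS h hn fun x' hx' => ?_⟩
    obtain ⟨y, hy, hyx⟩ := hd x' hx'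
    exact ⟨y, hy, fun j => (nsmul_le_nsmul_left (CuSemigroup.zero_le' _) (by omega)).trans (hyx j)⟩
  · obtain ⟨m, hm, n, hn, hd⟩ := hx x
    refine ⟨m, hm, n, hn, fun x' hx' => ?_⟩
    obtain ⟨y, hy, hyx⟩ := hd x' hx'
    exact ⟨fun _ => y, by simpa using hy, fun _ => hyx⟩

end Order

section Halving

variable {U : Type*} [CStarAlgebra U] [PartialOrder U] [StarOrderedRing U]

theorem exists_pos_mul_le (C : ℝ) {η : ℝ} (hη : 0 < η) : ∃ ε : ℝ, 0 < ε ∧ ε ≤ 1 ∧ ε * C ≤ η := by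
  refine ⟨min 1 (η / (|C| + 1)), by positivity, min_le_left _ _, ?_⟩
  calc min 1 (η / (|C| + 1)) * C ≤ min 1 (η / (|C| + 1)) * (|C| + 1) := by
        gcongr; linarith [le_abs_self C]
    _ ≤ η / (|C| + 1) * (|C| + 1) := by gcongr; exact min_le_right _ _
    _ = η := by field_simp

theorem norm_trunc_mul_sub_le {b : U} (hb : 0 ≤ b) {σ : ℝ} (hσ : 0 < σ) :
    ‖trunc b σ * b - b‖ ≤ σ := by
  have : trunc b σ * b - b = cfc (fun t : ℝ => min (t / σ) 1 * t - t) b := by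
    rw [cfc_sub _ _ b (by fun_prop) (by fun_prop), cfc_mul _ _ b (by fun_prop) (by fun_prop),
      cfc_id' ℝ b, trunc]
  rw [this]
  refine norm_cfc_le hσ.le fun t ht => ?_
  have ht0 : 0 ≤ t := spectrum_nonneg_of_nonneg hb ht
  rw [Real.norm_eq_abs, abs_le]
  rcases le_total t σ with h | h
  · rw [min_eq_left ((div_le_one hσ).2 h)]
    have h1 : 0 ≤ t / σ := by positivity
    have h2 : t / σ ≤ 1 := (div_le_one hσ).2 h
    constructor <;> nlinarith
  · rw [min_eq_right ((one_le_div hσ).2 h)]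
    constructor <;> linarith

theorem norm_one_sub_trunc_le {b : U} (hb : 0 ≤ b) {σ : ℝ} (hσ : 0 < σ) :
    ‖1 - trunc b σ‖ ≤ 1 :=
  (CStarAlgebra.norm_le_one_iff_of_nonneg _ (sub_nonneg.2 (trunc_le_one b σ))).2
    (sub_le_self _ (trunc_nonneg hb hσ))

theorem norm_mul_one_sub_trunc_le {b x : U} (hb : 0 ≤ b) (hx : star x * x ≤ b) {σ : ℝ}
    (hσ : 0 < σ) : ‖x * (1 - trunc b σ)‖ * ‖x * (1 - trunc b σ)‖ ≤ σ := by
  set χ := 1 - trunc b σ with hχ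
  have sχ : star χ = χ := by rw [hχ, star_sub, star_one, trunc_isSelfAdjoint]
  rw [← CStarRing.norm_star_mul_self, star_mul, sχ]
  have h1 : χ * star x * (x * χ) ≤ χ * b * χ := by
    have := star_left_conjugate_le_conjugate hx χ
    rw [sχ] at this
    calc χ * star x * (x * χ) = χ * (star x * x) * χ := by noncomm_ring
      _ ≤ _ := this
  have h0 : 0 ≤ χ * star x * (x * χ) := by
    have := star_mul_self_nonneg (x * χ)
    rwa [star_mul, sχ] at this
  refine (CStarAlgebra.norm_le_norm_of_nonneg_of_le h0 h1).trans ?_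
  have h2 : ‖b * χ‖ ≤ σ := by
    rw [hχ, mul_sub, mul_one, norm_sub_rev]
    have := norm_trunc_mul_sub_le hb hσ
    rwa [← norm_star, star_sub, star_mul, trunc_isSelfAdjoint, hb.isSelfAdjoint.star_eq] at this
  calc ‖χ * b * χ‖ ≤ ‖χ‖ * ‖b * χ‖ := by rw [mul_assoc]; exact norm_mul_le _ _
    _ ≤ 1 * σ := by gcongr; exact norm_one_sub_trunc_le hb hσ
    _ = σ := one_mul σ

theorem exists_approx_isometry {b₁ b₂ m : U} (h₁ : 0 ≤ b₁) (h₂ : 0 ≤ b₂) (h : b₁ * b₂ = 0)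
    (hm : 0 ≤ m) (hbm : CSub (b₁ + b₂) m) {τ : ℝ} (hτ : 0 < τ) :
    ∃ r : U, ‖star (m * r) * (m * r) * b₁ - b₁‖ ≤ τ ∧ ‖star (m * r) * (m * r) * b₂ - b₂‖ ≤ τ := by
  obtain ⟨ε, hε, -, hε1⟩ := exists_pos_mul_le (‖b₁‖ + ‖b₂‖) (half_pos hτ)
  set σ := τ / 2 with hσ
  have hσ0 : 0 < σ := by positivity
  set u := trunc b₁ σ + trunc b₂ σ with hu
  have hum : CSub u m :=
    (CSub.add h₁ h₂ h (trunc_csub h₁ hσ0) (trunc_csub h₂ hσ0)).trans hbm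
  obtain ⟨r, hr⟩ := exists_norm_star_mul_sq_mul_sub_lt hm hum hε
  have h' := mul_eq_zero_symm h₁ h₂ h
  have hu₁ : u * b₁ = trunc b₁ σ * b₁ := by
    rw [hu, add_mul, trunc_mul_eq_zero h₂ hσ0 h', add_zero]
  have hu₂ : u * b₂ = trunc b₂ σ * b₂ := by
    rw [hu, add_mul, trunc_mul_eq_zero h₁ hσ0 h, zero_add]
  have key : ∀ b : U, ‖u * b - b‖ ≤ σ → ‖b‖ ≤ ‖b₁‖ + ‖b₂‖ →
      ‖star (m * r) * (m * r) * b - b‖ ≤ τ := fun b hub hb => by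
    have e : star (m * r) * (m * r) * b - b = (star (m * r) * (m * r) - u) * b + (u * b - b) := by
      noncomm_ring
    rw [e]
    calc _ ≤ ‖(star (m * r) * (m * r) - u) * b‖ + ‖u * b - b‖ := norm_add_le _ _
      _ ≤ ε * (‖b₁‖ + ‖b₂‖) + σ := by
        gcongr
        exact (norm_mul_le _ _).trans (by gcongr)
      _ ≤ τ := by rw [hσ]; linarith
  exact ⟨r, key _ (hu₁ ▸ norm_trunc_mul_sub_le h₁ hσ0) (by linarith [norm_nonneg b₂]),
    key _ (hu₂ ▸ norm_trunc_mul_sub_le h₂ hσ0) (by linarith [norm_nonneg b₁])⟩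

theorem norm_cube_sub_cube_le {g h χ : U} (hχ : ‖χ‖ ≤ 1) {ε : ℝ} (hε : ε ≤ 1)
    (hgh : ‖g - h‖ ≤ ε) :
    ‖g * χ * g * χ * g - h * χ * h * χ * h‖ ≤ ε * (3 * (‖h‖ + 1) ^ 2) := by
  have hg : ‖g‖ ≤ ‖h‖ + 1 := by
    have := norm_add_le (g - h) h
    rw [sub_add_cancel] at this
    linarith
  have hh : ‖h‖ ≤ ‖h‖ + 1 := by linarith
  have e : g * χ * g * χ * g - h * χ * h * χ * h =
      (g - h) * (χ * g * χ * g) + h * χ * (g - h) * (χ * g) + h * χ * h * χ * (g - h) := by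
    noncomm_ring
  have hε0 : 0 ≤ ε := (norm_nonneg _).trans hgh
  have b1 : ‖(g - h) * (χ * g * χ * g)‖ ≤ ε * (1 * (‖h‖ + 1) * 1 * (‖h‖ + 1)) := by
    refine (norm_mul_le _ _).trans ?_
    gcongr
    refine (norm_mul_le _ _).trans ?_
    gcongr
    refine (norm_mul_le _ _).trans ?_
    gcongr
    refine (norm_mul_le _ _).trans ?_
    gcongr
  have b2 : ‖h * χ * (g - h) * (χ * g)‖ ≤ (‖h‖ + 1) * 1 * ε * (1 * (‖h‖ + 1)) := by
    refine (norm_mul_le _ _).trans ?_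
    gcongr
    · refine (norm_mul_le _ _).trans ?_
      gcongr
      refine (norm_mul_le _ _).trans ?_
      gcongr
    · refine (norm_mul_le _ _).trans ?_
      gcongr
  have b3 : ‖h * χ * h * χ * (g - h)‖ ≤ (‖h‖ + 1) * 1 * (‖h‖ + 1) * 1 * ε := by
    refine (norm_mul_le _ _).trans ?_
    gcongr
    refine (norm_mul_le _ _).trans ?_
    gcongr
    refine (norm_mul_le _ _).trans ?_
    gcongr
    refine (norm_mul_le _ _).trans ?_
    gcongr
  rw [e]
  refine (norm_add₃_le).trans ?_
  linarith

theorem cube_le_two_smul {h μ : U} (hh : 0 ≤ h) (hμ : star μ = μ) :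
    h ^ 3 ≤ (2 : ℝ) • (h * (1 - μ) * h * (1 - μ) * h) + (2 : ℝ) • (h * μ * h * μ * h) := by
  have h0 : 0 ≤ star ((1 - μ - μ) * h) * h * ((1 - μ - μ) * h) :=
    star_left_conjugate_nonneg hh _
  have e : star ((1 - μ - μ) * h) * h * ((1 - μ - μ) * h) =
      (2 : ℝ) • (h * (1 - μ) * h * (1 - μ) * h) + (2 : ℝ) • (h * μ * h * μ * h) - h ^ 3 := by
    rw [star_mul, star_sub, star_sub, star_one, hμ, hh.isSelfAdjoint.star_eq, two_smul, two_smul]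
    noncomm_ring
  rw [e] at h0
  exact sub_nonneg.1 h0

set_option maxHeartbeats 1000000 in
/-- If two orthogonal copies of `b` fit below `P + Q`, then up to two copies of `P` the element `b`
is dominated by an element `q` two orthogonal copies of which fit below `Q`. -/
theorem exists_halving (F : U →⋆ₐ[ℂ] ℂ) {b₁ b₂ P Q : U} (h₁ : 0 ≤ b₁) (h₂ : 0 ≤ b₂)
    (h₁₂ : b₁ * b₂ = 0) (h : CSub b₁ b₂) (hP : 0 ≤ P) (hQ : 0 ≤ Q) (hPQ : P * Q = 0)
    (hb : CSub (b₁ + b₂) (P + Q)) (F₁ : F b₁ = 0) (F₂ : F b₂ = 0) (FP : F P = 0)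
    {η : ℝ} (hη : 0 < η) :
    ∃ q y₁ y₂ p₁ p₂ : U, (0 ≤ q ∧ 0 ≤ y₁ ∧ 0 ≤ y₂ ∧ 0 ≤ p₁ ∧ 0 ≤ p₂) ∧
      (F q = 0 ∧ F y₁ = 0 ∧ F y₂ = 0 ∧ F p₁ = 0 ∧ F p₂ = 0) ∧ y₁ * y₂ = 0 ∧
      CSub q y₁ ∧ CSub q y₂ ∧ CSub (y₁ + y₂) Q ∧ CSub p₁ P ∧ CSub p₂ P ∧
      ∃ c d : U, 0 ≤ c ∧ 0 ≤ d ∧ F c = 0 ∧ F d = 0 ∧ CSub (cut (b₁ ^ 6) (2 * η)) (c + d) ∧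
        CSub c q ∧ CSub d (p₁ + p₂) := by
  have s₁ : star b₁ = b₁ := h₁.isSelfAdjoint.star_eq
  have s₂ : star b₂ = b₂ := h₂.isSelfAdjoint.star_eq
  have sP : star P = P := hP.isSelfAdjoint.star_eq
  have sQ : star Q = Q := hQ.isSelfAdjoint.star_eq
  have hQP := mul_eq_zero_symm hP hQ hPQ
  set h := b₁ * b₁ with hh
  have hh0 : 0 ≤ h := by have := star_mul_self_nonneg b₁; rwa [s₁] at this
  have sh : star h = h := hh0.isSelfAdjoint.star_eq
  obtain ⟨ε₀, hε₀, hε₀1, hε₀h⟩ := exists_pos_mul_le (3 * (‖h‖ + 1) ^ 2) (half_pos hη)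
  obtain ⟨ρ, hρ⟩ := exists_norm_star_mul_sq_mul_sub_lt h₂
    ((mul_csub_self h₁).trans ‹CSub b₁ b₂›) hε₀
  set w := b₂ * ρ with hw
  clear_value w
  have b₁w : b₁ * w = 0 := by rw [hw, ← mul_assoc, h₁₂, zero_mul]
  have wb₁ : star w * b₁ = 0 := by
    have := congrArg star b₁w
    rwa [star_mul, s₁, star_zero] at this
  obtain ⟨ε₁, hε₁, -, hε₁w⟩ := exists_pos_mul_le (‖b₁‖ * ‖b₁‖ + ‖w‖ * ‖w‖) (half_pos hη)
  obtain ⟨τ, hτ, -, hτw⟩ := exists_pos_mul_le ((‖b₁‖ + ‖w‖) * (‖b₁‖ + ‖w‖)) hε₁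
  obtain ⟨τ', hτ', -, hτ'w⟩ := exists_pos_mul_le ((‖b₁‖ + ‖w‖) * (1 + ‖ρ‖)) (half_pos hτ)
  obtain ⟨r, hr₁, hr₂⟩ := exists_approx_isometry h₁ h₂ h₁₂ (add_nonneg hP hQ) hb hτ'
  set G := star ((P + Q) * r) * ((P + Q) * r) with hG
  have hG' : G = star r * P * P * r + star r * Q * Q * r := by
    have : G = star r * P * P * r + star r * Q * Q * r + star r * (P * Q) * r +
        star r * (Q * P) * r := by
      rw [hG, star_mul, star_add, sP, sQ]; noncomm_ring
    rw [this, hPQ, hQP]; simp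
  have hrw : ‖G * w - w‖ ≤ τ' * (1 + ‖ρ‖) := by
    have e : G * w - w = (G * b₂ - b₂) * ρ := by rw [hw]; noncomm_ring
    rw [e]
    calc _ ≤ ‖G * b₂ - b₂‖ * ‖ρ‖ := norm_mul_le _ _
      _ ≤ τ' * (1 + ‖ρ‖) := by gcongr; linarith
  have hr₁' : ‖G * b₁ - b₁‖ ≤ τ' * (1 + ‖ρ‖) := by
    refine hr₁.trans ?_
    nlinarith [norm_nonneg ρ]
  set p₁ := star (P * r * b₁) * (P * r * b₁) with hp₁
  set p₂ := star (P * r * w) * (P * r * w) with hp₂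
  have p₁0 : 0 ≤ p₁ := star_mul_self_nonneg _
  have p₂0 : 0 ≤ p₂ := star_mul_self_nonneg _
  set M := p₁ + p₂ with hM
  have M0 : 0 ≤ M := add_nonneg p₁0 p₂0
  set μ := trunc M (τ / 2) with hμ
  have sμ : star μ = μ := trunc_isSelfAdjoint _ _
  set χ := 1 - μ with hχ
  have sχ : star χ = χ := by rw [hχ, star_sub, star_one, sμ]
  have χ1 : ‖χ‖ ≤ 1 := norm_one_sub_trunc_le M0 (half_pos hτ)
  have π₁χ : ‖P * r * b₁ * χ‖ * ‖P * r * b₁ * χ‖ ≤ τ / 2 :=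
    norm_mul_one_sub_trunc_le M0 (le_add_of_nonneg_right p₂0) (half_pos hτ)
  have π₂χ : ‖P * r * w * χ‖ * ‖P * r * w * χ‖ ≤ τ / 2 :=
    norm_mul_one_sub_trunc_le M0 (le_add_of_nonneg_left p₁0) (half_pos hτ)
  have entry : ∀ x y : U, ‖x‖ ≤ ‖b₁‖ + ‖w‖ → ‖G * y - y‖ ≤ τ' * (1 + ‖ρ‖) →
      ‖P * r * x * χ‖ * ‖P * r * x * χ‖ ≤ τ / 2 → ‖P * r * y * χ‖ * ‖P * r * y * χ‖ ≤ τ / 2 →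
      ‖star (Q * r * x * χ) * (Q * r * y * χ) - χ * (star x * y) * χ‖ ≤ τ := by
    intro x y hx hy hPx hPy
    have e : star (Q * r * x * χ) * (Q * r * y * χ) - χ * (star x * y) * χ =
        χ * (star x * (G * y - y)) * χ - star (P * r * x * χ) * (P * r * y * χ) := by
      rw [hG']
      simp only [star_mul, sχ, sP, sQ]
      noncomm_ring
    have b1 : ‖χ * (star x * (G * y - y)) * χ‖ ≤
        1 * ((‖b₁‖ + ‖w‖) * (τ' * (1 + ‖ρ‖))) * 1 := by
      refine (norm_mul_le _ _).trans ?_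
      gcongr
      refine (norm_mul_le _ _).trans ?_
      gcongr
      refine (norm_mul_le _ _).trans ?_
      rw [norm_star]
      gcongr
    have b2 : ‖star (P * r * x * χ) * (P * r * y * χ)‖ ≤ τ / 2 := by
      refine (norm_mul_le _ _).trans ?_
      rw [norm_star]
      nlinarith [sq_nonneg (‖P * r * x * χ‖ - ‖P * r * y * χ‖)]
    rw [e]
    refine (norm_sub_le _ _).trans ?_
    linarith
  set A₁ := b₁ * χ * star b₁ * (b₁ * χ * star b₁) with hA₁
  set A₂ := w * χ * star w * (w * χ * star w) with hA₂
  have A₁0 : 0 ≤ A₁ := by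
    have := star_mul_self_nonneg (b₁ * χ * star b₁)
    rwa [star_mul, star_mul, star_star, sχ, ← mul_assoc b₁ χ] at this
  have A₂0 : 0 ≤ A₂ := by
    have := star_mul_self_nonneg (w * χ * star w)
    rwa [star_mul, star_mul, star_star, sχ, ← mul_assoc w χ] at this
  have A₁₂ : A₁ * A₂ = 0 := by
    have : A₁ * A₂ =
        b₁ * χ * star b₁ * (b₁ * χ * (star b₁ * w) * χ * star w * (w * χ * star w)) := by
      rw [hA₁, hA₂]; noncomm_ring
    rw [this, s₁, b₁w]; simp
  set ζ := Q * (r * b₁ * χ * star b₁ + r * w * χ * star w) with hζ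
  have hζA : ‖A₁ + A₂ - star ζ * ζ‖ ≤ ε₁ := by
    have n₁ : ‖b₁‖ ≤ ‖b₁‖ + ‖w‖ := le_add_of_nonneg_right (norm_nonneg _)
    have n₂ : ‖w‖ ≤ ‖b₁‖ + ‖w‖ := le_add_of_nonneg_left (norm_nonneg _)
    have e : star ζ * ζ - (A₁ + A₂) =
        b₁ * (star (Q * r * b₁ * χ) * (Q * r * b₁ * χ) - χ * (star b₁ * b₁) * χ) * star b₁ +
        b₁ * (star (Q * r * b₁ * χ) * (Q * r * w * χ) - χ * (star b₁ * w) * χ) * star w +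
        w * (star (Q * r * w * χ) * (Q * r * b₁ * χ) - χ * (star w * b₁) * χ) * star b₁ +
        w * (star (Q * r * w * χ) * (Q * r * w * χ) - χ * (star w * w) * χ) * star w +
        (b₁ * χ * (star b₁ * w) * χ * star w + w * χ * (star w * b₁) * χ * star b₁) := by
      rw [hA₁, hA₂, hζ]
      simp only [star_mul, star_add, star_star, sχ, sQ]
      noncomm_ring
    have bd : ∀ x y E : U, ‖E‖ ≤ τ → ‖x * E * star y‖ ≤ ‖x‖ * τ * ‖y‖ := fun x y E hE => by
      refine (norm_mul_le _ _).trans ?_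
      rw [norm_star]
      gcongr
      refine (norm_mul_le _ _).trans ?_
      gcongr
    have e0 : b₁ * χ * (star b₁ * w) * χ * star w + w * χ * (star w * b₁) * χ * star b₁ = 0 := by
      rw [wb₁, s₁, b₁w]; simp
    rw [norm_sub_rev, e, e0, add_zero]
    refine norm_add₄_le.trans ?_
    have d₁ := bd b₁ b₁ _ (entry b₁ b₁ n₁ hr₁' π₁χ π₁χ)
    have d₂ := bd b₁ w _ (entry b₁ w n₁ hrw π₁χ π₂χ)
    have d₃ := bd w b₁ _ (entry w b₁ n₂ hr₁' π₂χ π₁χ)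
    have d₄ := bd w w _ (entry w w n₂ hrw π₂χ π₂χ)
    linarith
  set k := h * χ * h * χ * h with hk
  have k0 : 0 ≤ k := by
    have := star_left_conjugate_nonneg hh0 (χ * h)
    rwa [star_mul, sχ, sh, ← mul_assoc] at this
  have cut_k : ∀ x A : U, 0 ≤ A → ‖x‖ * ‖x‖ ≤ ‖b₁‖ * ‖b₁‖ + ‖w‖ * ‖w‖ →
      ‖star x * A * x - k‖ ≤ η / 2 → CSub (cut k η) (cut A ε₁) := fun x A hA hx hxk => by
    refine (cut_csub_of_norm_sub_le (b := star x * cut A ε₁ * x) k0.isSelfAdjoint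
      (star_left_conjugate_nonneg (cut_nonneg _ _) _).isSelfAdjoint ?_).trans (csub_star_conj _ _)
    have e : k - star x * cut A ε₁ * x =
        -(star x * A * x - k) - star x * (cut A ε₁ - A) * x := by noncomm_ring
    have b1 : ‖star x * (cut A ε₁ - A) * x‖ ≤ ‖x‖ * ε₁ * ‖x‖ := by
      refine (norm_mul_le _ _).trans ?_
      gcongr
      refine (norm_mul_le _ _).trans ?_
      rw [norm_star]
      gcongr
      exact norm_cut_sub_le hA hε₁.le
    rw [e]
    refine (norm_sub_le _ _).trans ?_
    rw [norm_neg]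
    nlinarith
  have q₁ : CSub (cut k η) (cut A₁ ε₁) := by
    refine cut_k b₁ A₁ A₁0 (by nlinarith [norm_nonneg w]) ?_
    have : star b₁ * A₁ * b₁ - k = 0 := by
      rw [hA₁, hk, hh, s₁]; noncomm_ring
    rw [this, norm_zero]
    positivity
  have q₂ : CSub (cut k η) (cut A₂ ε₁) := by
    refine cut_k w A₂ A₂0 (by nlinarith [norm_nonneg b₁]) ?_
    have : star w * A₂ * w = star w * w * χ * (star w * w) * χ * (star w * w) := by
      rw [hA₂]; noncomm_ring
    rw [this, hk]
    exact (norm_cube_sub_cube_le χ1 hε₀1 hρ.le).trans hε₀h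
  have Fw : F w = 0 := by rw [hw, map_mul, F₂, zero_mul]
  have Fh : F h = 0 := by rw [hh, map_mul, F₁, zero_mul]
  have FA₁ : F A₁ = 0 := by rw [hA₁]; simp [F₁]
  have FA₂ : F A₂ = 0 := by rw [hA₂]; simp [Fw]
  have Fk : F k = 0 := by rw [hk]; simp [Fh]
  have hyy : cut A₁ ε₁ * cut A₂ ε₁ = 0 :=
    mul_cut_eq_zero A₂0 hε₁ (cut_mul_eq_zero A₁0 hε₁ A₁₂)
  have hyQ : CSub (cut A₁ ε₁ + cut A₂ ε₁) Q := by
    refine (cut_add_cut_csub A₁0 A₂0 A₁₂ hε₁ (sub_le_of_norm_sub_le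
      (add_nonneg A₁0 A₂0).isSelfAdjoint (IsSelfAdjoint.star_mul_self _) hζA)).trans ?_
    refine (csub_star_mul ζ).trans ?_
    have := factor_csub hQ 1 (r * b₁ * χ * star b₁ + r * w * χ * star w)
    rwa [one_mul] at this
  have pP : ∀ x : U, CSub (star (P * r * x) * (P * r * x)) P := fun x => by
    refine (csub_star_mul _).trans ?_
    have := factor_csub hP 1 (r * x)
    rwa [one_mul, ← mul_assoc] at this
  set d := h * μ * h * μ * h with hd
  have d0 : 0 ≤ d := by
    have := star_left_conjugate_nonneg hh0 (μ * h)
    rwa [star_mul, sμ, sh, ← mul_assoc] at this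
  have dM : CSub d M := by
    have e : d = h * μ * b₁ * star (h * μ * b₁) := by
      simp only [star_mul, sμ, sh, s₁]
      rw [hd, hh]; noncomm_ring
    rw [e]
    exact (factor_csub (trunc_nonneg M0 (half_pos hτ)) _ _).trans (trunc_csub M0 (half_pos hτ))
  refine ⟨cut k η, cut A₁ ε₁, cut A₂ ε₁, p₁, p₂,
    ⟨cut_nonneg _ _, cut_nonneg _ _, cut_nonneg _ _, p₁0, p₂0⟩,
    ⟨map_cut_eq_zero F k0 Fk hη, map_cut_eq_zero F A₁0 FA₁ hε₁, map_cut_eq_zero F A₂0 FA₂ hε₁,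
      by rw [hp₁]; simp [FP], by rw [hp₂]; simp [FP]⟩, hyy, q₁, q₂, hyQ, pP b₁, pP w,
    (2 : ℝ) • cut k η, (2 : ℝ) • d, smul_nonneg zero_le_two (cut_nonneg _ _),
    smul_nonneg zero_le_two d0, ?_, ?_, ?_, csub_smul _ zero_le_two,
    (csub_smul _ zero_le_two).trans dM⟩
  · rw [two_smul, map_add, map_cut_eq_zero F k0 Fk hη, add_zero]
  · rw [two_smul, map_add, hd]; simp [Fh]
  · have e : b₁ ^ 6 = h ^ 3 := by rw [hh]; noncomm_ring
    rw [e]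
    refine cut_csub_of_sub_le (CStarAlgebra.pow_nonneg hh0 3).isSelfAdjoint ?_
    have c1 := cube_le_two_smul hh0 sμ
    have c2 : k - algebraMap ℝ U η ≤ cut k η :=
      sub_le_of_norm_sub_le k0.isSelfAdjoint (cut_nonneg _ _).isSelfAdjoint
        (by rw [norm_sub_rev]; exact norm_cut_sub_le k0 hη.le)
    have c3 : (2 : ℝ) • k - algebraMap ℝ U (2 * η) ≤ (2 : ℝ) • cut k η := by
      have := smul_le_smul_of_nonneg_left c2 (zero_le_two (α := ℝ))
      rwa [smul_sub, Algebra.algebraMap_eq_smul_one η, smul_smul,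
        ← Algebra.algebraMap_eq_smul_one] at this
    calc h ^ 3 - algebraMap ℝ U (2 * η)
        ≤ (2 : ℝ) • k + (2 : ℝ) • d - algebraMap ℝ U (2 * η) := sub_le_sub_right c1 _
      _ = ((2 : ℝ) • k - algebraMap ℝ U (2 * η)) + (2 : ℝ) • d := by abel
      _ ≤ _ := by gcongr

end Halving

section Model

variable {U : Type*} [CStarAlgebra U] [PartialOrder U] [StarOrderedRing U]

/-- Self-adjoint elements mapped to `1` by `F` are limits of such elements which are invertible. -/
def SelfAdjointUnitsDense (F : U →⋆ₐ[ℂ] ℂ) : Prop :=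
  ∀ D : U, F D = 1 → IsSelfAdjoint D → ∀ δ : ℝ, 0 < δ →
    ∃ T : U, IsUnit T ∧ IsSelfAdjoint T ∧ F T = 1 ∧ ‖T - D‖ < δ

theorem cut_csub_cut {a : U} (ha : 0 ≤ a) {δ ε : ℝ} (h : δ ≤ ε) :
    CSub (cut a ε) (cut a δ) := by
  have := cut_csub (cut_nonneg a δ) (sub_nonneg.2 h)
  rwa [cut_cut ha.isSelfAdjoint (sub_nonneg.2 h), add_sub_cancel] at this

theorem exists_csub_cut_of_isUnit {y : U} (hy : IsSelfAdjoint y) (hu : IsUnit y) :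
    ∃ δ : ℝ, 0 < δ ∧ CSub (cut y 0) (cut (cut y 0) δ) := by
  have h0 : (0 : ℝ) ∈ (spectrum ℝ y)ᶜ := by
    rwa [Set.mem_compl_iff, spectrum.zero_notMem_iff]
  obtain ⟨δ, hδ, hball⟩ := Metric.isOpen_iff.1 (spectrum.isClosed (𝕜 := ℝ) y).isOpen_compl 0 h0
  refine ⟨δ / 2, by positivity, ?_⟩
  rw [cut_cut hy (by positivity), zero_add]
  refine CSub.trans (b := (2 : ℝ) • cut y (δ / 2)) (csub_of_le (cut_nonneg _ _) ?_)
    (csub_smul _ zero_le_two)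
  rw [cut, cut, ← cfc_smul (2 : ℝ) _ y (by fun_prop)]
  refine cfc_mono (fun t ht => ?_) (by fun_prop) (by fun_prop)
  have : ¬ |t| < δ := fun h => hball (by simpa using h) ht
  simp only [smul_eq_mul, sub_zero]
  rcases le_total t 0 with h | h
  · rw [max_eq_right h]
    exact mul_nonneg zero_le_two (le_max_right _ _)
  · rw [abs_of_nonneg h, not_lt] at this
    rw [max_eq_left h]
    linarith [le_max_left (t - δ / 2) 0]

theorem SelfAdjointUnitsDense.exists_compact {F : U →⋆ₐ[ℂ] ℂ} (hd : SelfAdjointUnitsDense F)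
    {b : U} (hb : 0 ≤ b) (Fb : F b = 0) {ε : ℝ} (hε : 0 < ε) :
    ∃ p : U, 0 ≤ p ∧ F p = 0 ∧ CSub (cut b ε) p ∧ CSub p b ∧
      ∃ δ : ℝ, 0 < δ ∧ CSub p (cut p δ) := by
  obtain ⟨T, hT, sT, FT, hTD⟩ := hd (1 - (2 / ε) • b) (by
    have : F ((2 / ε) • b) = 0 := by
      rw [← smul_one_mul, map_mul, Fb, mul_zero]
    rw [map_sub, map_one, this, sub_zero])
    ((IsSelfAdjoint.one U).sub (IsSelfAdjoint.smul (.all (2 / ε)) hb.isSelfAdjoint)) 1 one_pos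
  set y := (-(ε / 2)) • T with hy
  have sy : IsSelfAdjoint y := IsSelfAdjoint.smul (.all _) sT
  have uy : IsUnit y := by
    have : IsUnit ((Units.mk0 (-(ε / 2)) (by linarith : -(ε / 2) ≠ 0)) • T) := hT.smul _
    exact this
  have hyb : ‖b - algebraMap ℝ U (ε / 2) - y‖ ≤ ε / 2 := by
    have e : b - algebraMap ℝ U (ε / 2) - y = (ε / 2) • (T - (1 - (2 / ε) • b)) := by
      have : (ε / 2 * (2 / ε)) = 1 := by field_simp
      rw [hy, Algebra.algebraMap_eq_smul_one, smul_sub, smul_sub, smul_smul, this, one_smul,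
        neg_smul]
      abel
    rw [e, norm_smul, Real.norm_of_nonneg (by positivity)]
    nlinarith
  have sb : IsSelfAdjoint (b - algebraMap ℝ U (ε / 2)) :=
    hb.isSelfAdjoint.sub (IsSelfAdjoint.algebraMap U (.all _))
  have hm : algebraMap ℝ U (ε / 2) + algebraMap ℝ U (ε / 2) = algebraMap ℝ U ε := by
    rw [← map_add, add_halves]
  have h1 : b - algebraMap ℝ U ε ≤ y := by
    have := sub_le_of_norm_sub_le sb sy hyb
    rwa [sub_sub, hm] at this
  have h2 : y ≤ b := by
    have := sub_le_of_norm_sub_le sy sb ((norm_sub_rev _ _).trans_le hyb)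
    rwa [sub_le_sub_iff_right] at this
  have hy0 : y ≤ cut y 0 := by
    nth_rw 1 [← cfc_id' ℝ y]
    rw [cut]
    refine cfc_mono (fun t _ => ?_) (by fun_prop) (by fun_prop)
    simp
  refine ⟨cut y 0, cut_nonneg _ _, ?_, cut_csub_of_sub_le hb.isSelfAdjoint (h1.trans hy0),
    cut_csub_of_sub_le sy (by simpa using h2), exists_csub_cut_of_isUnit sy uy⟩
  have Fy : F y = algebraMap ℝ ℂ (-(ε / 2)) := by
    rw [hy, ← smul_one_mul, map_mul, FT, mul_one, ← Algebra.algebraMap_eq_smul_one]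
    have : algebraMap ℝ U (-(ε / 2)) = algebraMap ℂ U ((-(ε / 2) : ℝ) : ℂ) := by
      rw [IsScalarTower.algebraMap_apply ℝ ℂ U]; rfl
    rw [this, AlgHomClass.commutes]
    rfl
  rw [cut, StarAlgHomClass.map_cfc (R := ℝ) F _ y (by fun_prop) (by fun_prop) sy (sy.map F), Fy,
    cfc_algebraMap]
  rw [max_eq_right (by linarith), map_zero]

variable {S : Type*} [CuSemigroup S]

/-- The map `cl` identifies `S` with the Cuntz classes of the positive elements of the kernel of
the character `F`. -/
structure CuModel (F : U →⋆ₐ[ℂ] ℂ) (cl : U → S) : Prop where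
  le_iff : ∀ {a b : U}, 0 ≤ a → 0 ≤ b → F a = 0 → F b = 0 → (cl a ≤ cl b ↔ CSub a b)
  add_orth : ∀ {a b : U}, 0 ≤ a → 0 ≤ b → F a = 0 → F b = 0 → a * b = 0 → cl (a + b) = cl a + cl b
  exists_orth : ∀ x y : S, ∃ a b : U, 0 ≤ a ∧ 0 ≤ b ∧ F a = 0 ∧ F b = 0 ∧ a * b = 0 ∧
    cl a = x ∧ cl b = y
  wayBelow_iff : ∀ (x : S) {a : U}, 0 ≤ a → F a = 0 →
    (WayBelow x (cl a) ↔ ∃ ε : ℝ, 0 < ε ∧ x ≤ cl (cut a ε))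

namespace CuModel

variable {F : U →⋆ₐ[ℂ] ℂ} {cl : U → S}

theorem surj (hcl : CuModel F cl) (x : S) : ∃ a : U, 0 ≤ a ∧ F a = 0 ∧ cl a = x :=
  let ⟨a, _, ha, _, Fa, _, _, hx, _⟩ := hcl.exists_orth x x
  ⟨a, ha, Fa, hx⟩

theorem add_le (hcl : CuModel F cl) {a b : U} (ha : 0 ≤ a) (hb : 0 ≤ b) (Fa : F a = 0)
    (Fb : F b = 0) : cl (a + b) ≤ cl a + cl b := by
  obtain ⟨a', b', ha', hb', Fa', Fb', h, h1, h2⟩ := hcl.exists_orth (cl a) (cl b)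
  rw [← h1, ← h2, ← hcl.add_orth ha' hb' Fa' Fb' h]
  refine (hcl.le_iff (add_nonneg ha hb) (add_nonneg ha' hb') (by simp [Fa, Fb])
    (by simp [Fa', Fb'])).2 (CSub.add ha' hb' h ?_ ?_)
  · exact (hcl.le_iff ha ha' Fa Fa').1 h1.ge
  · exact (hcl.le_iff hb hb' Fb Fb').1 h2.ge

theorem le_cut_add_cut (hcl : CuModel F cl) {u : S} {a b : U} (ha : 0 ≤ a) (hb : 0 ≤ b)
    (Fa : F a = 0) (Fb : F b = 0) (h : a * b = 0) (hu : WayBelow u (cl a + cl b)) :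
    ∃ ε : ℝ, 0 < ε ∧ u ≤ cl (cut a ε + cut b ε) := by
  rw [← hcl.add_orth ha hb Fa Fb h] at hu
  obtain ⟨ε, hε, hu⟩ := (hcl.wayBelow_iff u (add_nonneg ha hb) (by simp [Fa, Fb])).1 hu
  refine ⟨ε, hε, hu.trans ((hcl.le_iff (cut_nonneg _ _) (add_nonneg (cut_nonneg _ _)
    (cut_nonneg _ _)) ?_ ?_).2 (cut_add_csub ha hb h hε))⟩
  · exact map_cut_eq_zero F (add_nonneg ha hb) (by simp [Fa, Fb]) hε
  · rw [map_add, map_cut_eq_zero F ha Fa hε, map_cut_eq_zero F hb Fb hε, add_zero]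

theorem addContinuous (hcl : CuModel F cl) : AddContinuous S := by
  intro u y z hu
  obtain ⟨a, b, ha, hb, Fa, Fb, h, rfl, rfl⟩ := hcl.exists_orth y z
  obtain ⟨ε, hε, hu⟩ := hcl.le_cut_add_cut ha hb Fa Fb h hu
  have Fa' := map_cut_eq_zero F ha Fa hε
  have Fb' := map_cut_eq_zero F hb Fb hε
  exact ⟨cl (cut a ε), cl (cut b ε), (hcl.wayBelow_iff _ ha Fa).2 ⟨ε, hε, le_rfl⟩,
    (hcl.wayBelow_iff _ hb Fb).2 ⟨ε, hε, le_rfl⟩,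
    hu.trans (hcl.add_le (cut_nonneg _ _) (cut_nonneg _ _) Fa' Fb')⟩

theorem almostCancellative (hcl : CuModel F cl) (hd : UnitsDense F) : AlmostCancellative S := by
  intro x y z h
  obtain ⟨b, c, hb, hc, Fb, Fc, hbc, rfl, hcz⟩ := hcl.exists_orth y z
  obtain ⟨a, c₀, ha, hc₀, Fa, Fc₀, hac, rfl, hc₀z⟩ := hcl.exists_orth x z
  nth_rw 2 [← hcz] at h
  rw [← hc₀z, ← hcl.add_orth ha hc₀ Fa Fc₀ hac] at h
  obtain ⟨ε, hε, h⟩ := hcl.le_cut_add_cut hb hc Fb Fc hbc h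
  have Fb' := map_cut_eq_zero F hb Fb hε
  have Fc' := map_cut_eq_zero F hc Fc hε
  rw [hcl.le_iff (add_nonneg ha hc₀) (add_nonneg (cut_nonneg _ _) (cut_nonneg _ _))
    (by simp [Fa, Fc₀]) (by simp [Fb', Fc'])] at h
  refine (hcl.le_iff ha hb Fa Fb).2 (hd.csub_cancel ha hb hc hc₀ Fb Fc hbc hac
    ((hcl.le_iff hc hc₀ Fc Fc₀).1 (by rw [hcz, hc₀z])) (half_pos hε) ?_)
  rwa [mul_div_cancel₀ _ two_ne_zero]

theorem almostInterpolation (hcl : CuModel F cl) (hd : UnitsDense F) : AlmostInterpolation S := by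
  intro x₁' x₁ x₂' x₂ c e h₁ h₂ h₁c h₁e h₂c h₂e
  obtain ⟨y₁, hx₁, hy₁⟩ := h₁.exists_between
  obtain ⟨y₂, hx₂, hy₂⟩ := h₂.exists_between
  obtain ⟨a₁, ha₁, Fa₁, rfl⟩ := hcl.surj y₁
  obtain ⟨a₂, ha₂, Fa₂, rfl⟩ := hcl.surj y₂
  obtain ⟨c, hc, Fc, rfl⟩ := hcl.surj c
  obtain ⟨e, he, Fe, rfl⟩ := hcl.surj e
  have ha₂4 : 0 ≤ a₂ ^ 4 := CStarAlgebra.pow_nonneg ha₂ 4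
  have Fa₂4 : F (a₂ ^ 4) = 0 := by simp [Fa₂]
  obtain ⟨ε₁, hε₁, h₁ε⟩ := (hcl.wayBelow_iff _ hc Fc).1 (hy₁.mono le_rfl h₁c)
  obtain ⟨ε₂, hε₂, h₂ε⟩ := (hcl.wayBelow_iff _ hc Fc).1 (hy₂.mono le_rfl h₂c)
  obtain ⟨η₁, hη₁, h₁η⟩ := (hcl.wayBelow_iff _ ha₁ Fa₁).1 hx₁
  obtain ⟨η₂, hη₂, h₂η⟩ := (hcl.wayBelow_iff _ ha₂4 Fa₂4).1
    (hx₂.mono le_rfl ((hcl.le_iff ha₂ ha₂4 Fa₂ Fa₂4).2 (csub_pow ha₂ 3)))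
  rw [hcl.le_iff ha₁ (cut_nonneg _ _) Fa₁ (map_cut_eq_zero F hc Fc hε₁)] at h₁ε
  rw [hcl.le_iff ha₂ (cut_nonneg _ _) Fa₂ (map_cut_eq_zero F hc Fc hε₂)] at h₂ε
  set δ := min ε₁ ε₂ / 2 with hδ
  have hδ0 : 0 < δ := by positivity
  have h2δ : 2 * δ = min ε₁ ε₂ := mul_div_cancel₀ _ two_ne_zero
  set η := min (min η₁ η₂) 1 with hη
  have hη0 : 0 < η := by positivity
  obtain ⟨s, Fs, hs₁, hs₂, hse, hsc⟩ := hd.exists_interpolant ha₁ ha₂ hc he Fc Fe hδ0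
    (h₁ε.trans (cut_csub_cut hc (h2δ.trans_le (min_le_left _ _))))
    (h₂ε.trans (cut_csub_cut hc (h2δ.trans_le (min_le_right _ _))))
    ((hcl.le_iff ha₁ he Fa₁ Fe).1 (hy₁.le.trans h₁e))
    ((hcl.le_iff ha₂ he Fa₂ Fe).1 (hy₂.le.trans h₂e)) hη0 (min_le_right _ _)
  have hss : 0 ≤ s * star s := mul_star_self_nonneg s
  have Fss : F (s * star s) = 0 := by simp [Fs]
  refine ⟨cl (s * star s), h₁η.trans ?_, h₂η.trans ?_, (hcl.le_iff hss hc Fss Fc).2 hsc,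
    (hcl.le_iff hss he Fss Fe).2 hse⟩
  · exact (hcl.le_iff (cut_nonneg _ _) hss (map_cut_eq_zero F ha₁ Fa₁ hη₁) Fss).2
      ((cut_csub_cut ha₁ ((min_le_left _ _).trans (min_le_left _ _))).trans hs₁)
  · exact (hcl.le_iff (cut_nonneg _ _) hss (map_cut_eq_zero F ha₂4 Fa₂4 hη₂) Fss).2
      ((cut_csub_cut ha₂4 ((min_le_left _ _).trans (min_le_right _ _))).trans hs₂)

theorem compactsDense (hcl : CuModel F cl) (hd : SelfAdjointUnitsDense F) : CompactsDense S := by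
  intro x' x h
  obtain ⟨b, hb, Fb, rfl⟩ := hcl.surj x
  obtain ⟨ε, hε, hx'⟩ := (hcl.wayBelow_iff _ hb Fb).1 h
  obtain ⟨p, hp, Fp, hbp, hpb, δ, hδ, hpp⟩ := hd.exists_compact hb Fb hε
  exact ⟨cl p, (hcl.wayBelow_iff _ hp Fp).2
    ⟨δ, hδ, (hcl.le_iff hp (cut_nonneg _ _) Fp (map_cut_eq_zero F hp Fp hδ)).2 hpp⟩,
    hx'.trans ((hcl.le_iff (cut_nonneg _ _) hp (map_cut_eq_zero F hb Fb hε) Fp).2 hbp),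
    (hcl.le_iff hp hb Fp Fb).2 hpb⟩

theorem halvesRemainders (hcl : CuModel F cl) : HalvesRemainders S := by
  intro y' y p e hy hpe
  obtain ⟨b₁, b₂, h₁, h₂, F₁, F₂, h₁₂, hb₁, hb₂⟩ := hcl.exists_orth y y
  obtain ⟨P, Q, hP, hQ, FP, FQ, hPQ, rfl, rfl⟩ := hcl.exists_orth p e
  have hb : CSub (b₁ + b₂) (P + Q) := by
    rw [← hcl.le_iff (add_nonneg h₁ h₂) (add_nonneg hP hQ) (by simp [F₁, F₂]) (by simp [FP, FQ]),
      hcl.add_orth h₁ h₂ F₁ F₂ h₁₂, hcl.add_orth hP hQ FP FQ hPQ, hb₁, hb₂]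
    exact hpe
  have hb₁₂ : CSub b₁ b₂ := (hcl.le_iff h₁ h₂ F₁ F₂).1 (by rw [hb₁, hb₂])
  have h6 : 0 ≤ b₁ ^ 6 := CStarAlgebra.pow_nonneg h₁ 6
  have F6 : F (b₁ ^ 6) = 0 := by simp [F₁]
  obtain ⟨η, hη, hy'⟩ := (hcl.wayBelow_iff _ h6 F6).1
    (hy.mono le_rfl (hb₁ ▸ (hcl.le_iff h₁ h6 F₁ F6).2 (csub_pow h₁ 5)))
  obtain ⟨q, y₁, y₂, p₁, p₂, ⟨hq, hy₁, hy₂, hp₁, hp₂⟩, ⟨Fq, Fy₁, Fy₂, Fp₁, Fp₂⟩, hyy, hqy₁, hqy₂,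
    hyQ, hp₁P, hp₂P, c, d, hc, hd, Fc, Fd, hcd, hcq, hdp⟩ :=
    exists_halving F h₁ h₂ h₁₂ hb₁₂ hP hQ hPQ hb F₁ F₂ FP (half_pos hη)
  rw [mul_div_cancel₀ _ (two_ne_zero' ℝ)] at hcd
  refine ⟨cl q, ?_, ?_⟩
  · calc cl q + cl q ≤ cl y₁ + cl y₂ := add_le_add ((hcl.le_iff hq hy₁ Fq Fy₁).2 hqy₁)
          ((hcl.le_iff hq hy₂ Fq Fy₂).2 hqy₂)
      _ = cl (y₁ + y₂) := (hcl.add_orth hy₁ hy₂ Fy₁ Fy₂ hyy).symm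
      _ ≤ cl Q := (hcl.le_iff (add_nonneg hy₁ hy₂) hQ (by simp [Fy₁, Fy₂]) FQ).2 hyQ
  · calc y' ≤ cl (cut (b₁ ^ 6) η) := hy'
      _ ≤ cl (d + c) := by
        rw [add_comm]
        exact (hcl.le_iff (cut_nonneg _ _) (add_nonneg hc hd) (map_cut_eq_zero F h6 F6 hη)
          (by simp [Fc, Fd])).2 hcd
      _ ≤ cl d + cl c := hcl.add_le hd hc Fd Fc
      _ ≤ cl (p₁ + p₂) + cl q := add_le_add
        ((hcl.le_iff hd (add_nonneg hp₁ hp₂) Fd (by simp [Fp₁, Fp₂])).2 hdp)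
        ((hcl.le_iff hc hq Fc Fq).2 hcq)
      _ ≤ cl p₁ + cl p₂ + cl q := add_le_add (hcl.add_le hp₁ hp₂ Fp₁ Fp₂) le_rfl
      _ ≤ cl P + cl P + cl q := add_le_add (add_le_add ((hcl.le_iff hp₁ hP Fp₁ FP).2 hp₁P)
        ((hcl.le_iff hp₂ hP Fp₂ FP).2 hp₂P)) le_rfl

end CuModel

end Model

section MatrixUnits

variable {V : Type*} [CStarAlgebra V]

/-- Matrices over `V` mapped to the identity by the character `F` (and self-adjoint if `p` holds)
are limits of invertible ones of the same kind. -/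
def MatrixUnitsDense (p : Prop) (F : V →⋆ₐ[ℂ] ℂ) (ι : Type*) [Fintype ι] [DecidableEq ι] : Prop :=
  ∀ D : Matrix ι ι V, D.map F = 1 → (p → IsSelfAdjoint D) → ∀ δ : ℝ, 0 < δ →
    ∃ T : Matrix ι ι V, IsUnit T ∧ (p → IsSelfAdjoint T) ∧ T.map F = 1 ∧
      ∀ i j, ‖T i j - D i j‖ < δ

theorem exists_isUnit_map_eq_one {p : Prop} (F : V →⋆ₐ[ℂ] ℂ)
    (h : ∀ x : V, (p → IsSelfAdjoint x) → x ∈ closure {y | (p → IsSelfAdjoint y) ∧ IsUnit y})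
    {d : V} (Fd : F d = 1) (hd : p → IsSelfAdjoint d) {δ : ℝ} (hδ : 0 < δ) :
    ∃ s : V, IsUnit s ∧ (p → IsSelfAdjoint s) ∧ F s = 1 ∧ ‖s - d‖ < δ := by
  have hF : Continuous F := map_continuous F
  have hc : ContinuousAt (fun y => (F y)⁻¹ • y) d :=
    (hF.continuousAt.inv₀ (by simp [Fd])).smul continuousAt_id
  have hnhds : {y | ‖(F y)⁻¹ • y - d‖ < δ} ∈ 𝓝 d := by
    have := hc.preimage_mem_nhds (t := Metric.ball d δ)
      (by simpa [Fd] using Metric.ball_mem_nhds d hδ)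
    simpa [Set.preimage, dist_eq_norm] using this
  obtain ⟨y, hy, hpy, huy⟩ := mem_closure_iff_nhds.1 (h d hd) _ hnhds
  have hFy : F y ≠ 0 := (huy.map F).ne_zero
  refine ⟨(F y)⁻¹ • y, ?_, fun hp => ?_, ?_, hy⟩
  · exact huy.smul (Units.mk0 _ (inv_ne_zero hFy))
  · have : IsSelfAdjoint (F y)⁻¹ := by
      rw [IsSelfAdjoint, star_inv₀, ← map_star, (hpy hp).star_eq]
    exact IsSelfAdjoint.smul this (hpy hp)
  · rw [map_smul, smul_eq_mul, inv_mul_cancel₀ hFy]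

theorem isUnit_fromBlocks_of_isUnit {ι κ : Type*} [Fintype ι] [DecidableEq ι] [Fintype κ]
    [DecidableEq κ] {R : Type*} [Ring R] {T N : Matrix ι ι R} (hTN : T * N = 1) (hNT : N * T = 1)
    (B : Matrix ι κ R) (C : Matrix κ ι R) {s : Matrix κ κ R} (hs : IsUnit s) :
    IsUnit (Matrix.fromBlocks T B C (s + C * N * B)) := by
  obtain ⟨⟨s, r, hsr, hrs⟩, rfl⟩ := hs
  have h1 : IsUnit (Matrix.fromBlocks (1 : Matrix ι ι R) 0 (C * N) (1 : Matrix κ κ R)) :=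
    isUnit_iff_exists.2 ⟨Matrix.fromBlocks 1 0 (-(C * N)) 1, by simp [Matrix.fromBlocks_multiply],
      by simp [Matrix.fromBlocks_multiply]⟩
  have h2 : IsUnit (Matrix.fromBlocks T 0 0 s) :=
    isUnit_iff_exists.2 ⟨Matrix.fromBlocks N 0 0 r,
      by simp [Matrix.fromBlocks_multiply, hTN, hsr],
      by simp [Matrix.fromBlocks_multiply, hNT, hrs]⟩
  have h3 : IsUnit (Matrix.fromBlocks (1 : Matrix ι ι R) (N * B) 0 (1 : Matrix κ κ R)) :=
    isUnit_iff_exists.2 ⟨Matrix.fromBlocks 1 (-(N * B)) 0 1,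
      by simp [Matrix.fromBlocks_multiply], by simp [Matrix.fromBlocks_multiply]⟩
  convert (h1.mul h2).mul h3 using 1
  have e1 : C * N * T = C := by rw [Matrix.mul_assoc, hNT, Matrix.mul_one]
  have e2 : T * (N * B) = B := by rw [← Matrix.mul_assoc, hTN, Matrix.one_mul]
  simp [Matrix.fromBlocks_multiply, e1, e2, Matrix.mul_assoc, add_comm]

namespace MatrixUnitsDense

variable {p : Prop} {F : V →⋆ₐ[ℂ] ℂ} {ι κ : Type*} [Fintype ι] [DecidableEq ι] [Fintype κ]
  [DecidableEq κ]

theorem map_mul_eq {l m n : Type*} [Fintype m] (F : V →⋆ₐ[ℂ] ℂ) (M : Matrix l m V)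
    (N : Matrix m n V) : (M * N).map F = M.map F * N.map F := by
  ext i j
  simp [Matrix.mul_apply]

theorem congr (e : ι ≃ κ) (h : MatrixUnitsDense p F ι) : MatrixUnitsDense p F κ := by
  intro D hD sD δ hδ
  obtain ⟨T, hT, sT, FT, hTD⟩ := h (D.submatrix e e) (by
    rw [← Matrix.submatrix_map, hD, Matrix.submatrix_one_equiv])
    (fun hp => by
      have := sD hp
      rw [IsSelfAdjoint, Matrix.star_eq_conjTranspose] at this ⊢
      rw [Matrix.conjTranspose_submatrix, this]) δ hδ
  refine ⟨T.submatrix e.symm e.symm, ?_, fun hp => ?_, ?_, fun i j => ?_⟩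
  · exact hT.map (Matrix.reindexRingEquiv V e)
  · have := sT hp
    rw [IsSelfAdjoint, Matrix.star_eq_conjTranspose] at this ⊢
    rw [Matrix.conjTranspose_submatrix, this]
  · rw [← Matrix.submatrix_map, FT, Matrix.submatrix_one_equiv]
  · simpa using hTD (e.symm i) (e.symm j)

theorem sum (h : MatrixUnitsDense p F ι) (h' : MatrixUnitsDense p F κ) :
    MatrixUnitsDense p F (ι ⊕ κ) := by
  intro D hD sD δ hδ
  obtain ⟨A, B, C, E, rfl⟩ : ∃ A B C E, D = Matrix.fromBlocks A B C E :=
    ⟨_, _, _, _, (Matrix.fromBlocks_toBlocks D).symm⟩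
  rw [Matrix.fromBlocks_map, ← Matrix.fromBlocks_one, Matrix.fromBlocks_inj] at hD
  obtain ⟨FA, FB, FC, FE⟩ := hD
  have sD' : p → A.conjTranspose = A ∧ C.conjTranspose = B ∧ B.conjTranspose = C ∧
      E.conjTranspose = E := fun hp => by
    have := sD hp
    rwa [IsSelfAdjoint, Matrix.star_eq_conjTranspose, Matrix.fromBlocks_conjTranspose,
      Matrix.fromBlocks_inj] at this
  obtain ⟨T, ⟨⟨T, N, hTN, hNT⟩, rfl⟩, sT, FT, hTA⟩ := h A FA (fun hp => (sD' hp).1) δ hδ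
  dsimp only at sT FT hTA
  have sN : p → N.conjTranspose = N := fun hp => by
    have h1 : T.conjTranspose = T := sT hp
    have h2 : N.conjTranspose * T = 1 := by
      rw [← h1, ← Matrix.conjTranspose_mul, hTN, Matrix.conjTranspose_one]
    exact left_inv_eq_right_inv h2 hTN
  have sc : p → (C * N * B).conjTranspose = C * N * B := fun hp => by
    obtain ⟨-, hC, hB, -⟩ := sD' hp
    rw [Matrix.conjTranspose_mul, Matrix.conjTranspose_mul, hB, hC, sN hp, Matrix.mul_assoc]
  have Fc : (C * N * B).map F = 0 := by rw [map_mul_eq, FB, Matrix.mul_zero]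
  obtain ⟨s, hs, ss, Fs, hsE⟩ := h' (E - C * N * B)
    (by rw [Matrix.map_sub F (map_sub F), FE, Fc, sub_zero])
    (fun hp => IsSelfAdjoint.sub (sD' hp).2.2.2 (sc hp)) δ hδ
  refine ⟨Matrix.fromBlocks T B C (s + C * N * B),
    isUnit_fromBlocks_of_isUnit hTN hNT B C hs, fun hp => ?_, ?_, ?_⟩
  · obtain ⟨-, hC, hB, -⟩ := sD' hp
    rw [IsSelfAdjoint, Matrix.star_eq_conjTranspose, Matrix.fromBlocks_conjTranspose, hB, hC,
      Matrix.conjTranspose_add, sc hp, show T.conjTranspose = T from sT hp,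
      show s.conjTranspose = s from ss hp]
  · rw [Matrix.fromBlocks_map, FT, FB, FC, Matrix.map_add F (map_add F), Fs, Fc, add_zero,
      Matrix.fromBlocks_one]
  · rintro (i | i) (j | j)
    · simpa using hTA i j
    · simpa using hδ
    · simpa using hδ
    · have := hsE i j
      rw [Matrix.sub_apply, ← sub_add] at this
      rwa [Matrix.fromBlocks_apply₂₂, Matrix.fromBlocks_apply₂₂, Matrix.add_apply,
        add_sub_right_comm]

theorem of_dense (h : ∀ x : V, (p → IsSelfAdjoint x) →
    x ∈ closure {y | (p → IsSelfAdjoint y) ∧ IsUnit y}) (n : ℕ) :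
    MatrixUnitsDense p F (Fin n) := by
  induction n with
  | zero =>
    intro D hD sD δ hδ
    exact ⟨D, ⟨1, Subsingleton.elim _ _⟩, sD, hD, fun i => i.elim0⟩
  | succ n ih =>
    refine congr finSumFinEquiv (sum ih ?_)
    intro D hD sD δ hδ
    obtain ⟨s, ⟨⟨s, r, hsr, hrs⟩, rfl⟩, ss, Fs, hsD⟩ := exists_isUnit_map_eq_one F h
      (d := D 0 0) (by simpa using congr_fun₂ hD 0 0)
      (fun hp => congr_fun₂ (sD hp) 0 0) hδ
    refine ⟨Matrix.of fun _ _ => s, isUnit_iff_exists.2 ⟨Matrix.of fun _ _ => r, ?_, ?_⟩,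
      fun hp => ?_, ?_, ?_⟩
    · ext i j
      rw [Subsingleton.elim j i]
      simpa [Matrix.mul_apply] using hsr
    · ext i j
      rw [Subsingleton.elim j i]
      simpa [Matrix.mul_apply] using hrs
    · ext i j
      exact ss hp
    · ext i j
      rw [Subsingleton.elim j i]
      simpa using Fs
    · intro i j
      simpa [Subsingleton.elim i 0, Subsingleton.elim j 0] using hsD

end MatrixUnitsDense

end MatrixUnits

section Stabilization

/-- The canonical character of the unitization, with kernel the original algebra. -/
def unitizationFst (B : Type*) [NonUnitalCStarAlgebra B] : Unitization ℂ B →⋆ₐ[ℂ] ℂ where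
  toAlgHom := Unitization.fstHom ℂ B
  map_star' := Unitization.fst_star

theorem unitizationFst_apply {B : Type*} [NonUnitalCStarAlgebra B] (x : Unitization ℂ B) :
    unitizationFst B x = x.fst := rfl

section Cuntz

variable {B : Type*} [NonUnitalCStarAlgebra B]

theorem eq_inr_of_unitizationFst_eq_zero {x : Unitization ℂ B} (h : unitizationFst B x = 0) :
    x = (x.snd : Unitization ℂ B) :=
  Unitization.ext h rfl

theorem cStarNonneg_iff {a : B} : CStarNonneg a ↔ 0 ≤ (a : Unitization ℂ B) := by
  let _ := CStarAlgebra.spectralOrder B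
  have := CStarAlgebra.spectralOrderedRing B
  rw [Unitization.inr_nonneg_iff, CStarAlgebra.nonneg_iff_eq_star_mul_self]
  rfl

theorem cuntzBelow_iff {a b : B} (hb : 0 ≤ (b : Unitization ℂ B)) :
    CuntzBelow a b ↔ CSub (a : Unitization ℂ B) (b : Unitization ℂ B) := by
  have key (r : B) : ‖(r : Unitization ℂ B) * b * star (r : Unitization ℂ B) - a‖ =
      ‖r * b * star r - a‖ := by
    rw [← Unitization.inr_star, ← Unitization.inr_mul, ← Unitization.inr_mul,
      ← Unitization.inr_sub, Unitization.norm_inr]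
  constructor
  · rintro ⟨r, hr⟩ ε hε
    obtain ⟨n, hn⟩ := ((Metric.tendsto_nhds.1 hr) ε hε).exists
    exact ⟨r n, by rwa [key, ← dist_eq_norm]⟩
  · intro h
    have h3 := h.trans (csub_pow hb 2)
    have (n : ℕ) : ∃ r : B, ‖r * b * star r - a‖ < 1 / ((n : ℝ) + 1) := by
      obtain ⟨r, hr⟩ := h3 (1 / ((n : ℝ) + 1)) (by positivity)
      have e := eq_inr_of_unitizationFst_eq_zero (x := r * (b : Unitization ℂ B))
        (by simp [unitizationFst_apply])
      refine ⟨(r * (b : Unitization ℂ B)).snd, ?_⟩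
      rw [← key, ← e, star_mul, hb.isSelfAdjoint.star_eq]
      convert hr using 3
      noncomm_ring
    choose r hr using this
    refine ⟨r, tendsto_iff_norm_sub_tendsto_zero.2 (squeeze_zero (fun _ => norm_nonneg _)
      (fun n => (hr n).le) tendsto_one_div_add_atTop_nhds_zero_nat)⟩

end Cuntz

variable {A : Type uu} [NonUnitalCStarAlgebra A] {S : Type vv} [CuSemigroup S]

namespace IsCuntzSemigroupOf

theorem cuModel (hS : IsCuntzSemigroupOf A S) :
    CuModel (unitizationFst hS.stab) (fun u => hS.cls u.snd) where
  le_iff {a b} ha hb Fa Fb := by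
    rw [eq_inr_of_unitizationFst_eq_zero Fa] at ha ⊢
    rw [eq_inr_of_unitizationFst_eq_zero Fb] at hb ⊢
    rw [← cuntzBelow_iff hb]
    exact hS.cls_le_iff _ _ (cStarNonneg_iff.2 ha) (cStarNonneg_iff.2 hb)
  add_orth {a b} ha hb Fa Fb h := by
    rw [eq_inr_of_unitizationFst_eq_zero Fa] at ha h
    rw [eq_inr_of_unitizationFst_eq_zero Fb] at hb h
    rw [Unitization.snd_add]
    refine hS.cls_add_orth _ _ (cStarNonneg_iff.2 ha) (cStarNonneg_iff.2 hb) ?_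
    rw [← Unitization.inr_mul] at h
    simpa using congrArg (fun z => z.snd) h
  exists_orth x y := by
    obtain ⟨a, ha, rfl⟩ := hS.cls_surj x
    obtain ⟨b, hb, rfl⟩ := hS.cls_surj y
    obtain ⟨a', b', ha', hb', h, h1, h2⟩ := hS.exists_orth a b ha hb
    refine ⟨a', b', cStarNonneg_iff.1 ha', cStarNonneg_iff.1 hb', by simp [unitizationFst_apply],
      by simp [unitizationFst_apply], ?_, h1, h2⟩
    rw [← Unitization.inr_mul, h, Unitization.inr_zero]
  wayBelow_iff x {a} ha Fa := by
    rw [eq_inr_of_unitizationFst_eq_zero Fa] at ha ⊢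
    refine (hS.waybelow_iff x a.snd (cStarNonneg_iff.2 ha)).trans (exists_congr fun ε =>
      and_congr_right fun hε => ?_)
    rw [cut, ← Unitization.real_cfcₙ_eq_cfc_inr _ _ (by simp [hε.le]), Unitization.snd_inr]

theorem norm_matEmb_single_le (hS : IsCuntzSemigroupOf A S) {n : ℕ} (i j : Fin n) (a : A) :
    ‖hS.matEmb n (Matrix.single i j a)‖ ≤ ‖a‖ := by
  let f : A →⋆ₙₐ[ℂ] hS.stab := (hS.matEmb n).comp
    { toFun := Matrix.single j j
      map_smul' := fun c x => (Matrix.smul_single c j j x).symm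
      map_zero' := Matrix.single_zero j j
      map_add' := Matrix.single_add j j
      map_mul' := fun x y => (Matrix.single_mul_single_same x j j j y).symm
      map_star' := fun x => (Matrix.conjTranspose_single j j x).symm }
  have h : star (hS.matEmb n (Matrix.single i j a)) * hS.matEmb n (Matrix.single i j a) =
      f (star a * a) := by
    rw [← map_star, ← map_mul, Matrix.star_eq_conjTranspose, Matrix.conjTranspose_single,
      Matrix.single_mul_single_same]
    rfl
  have h2 := NonUnitalStarAlgHom.norm_apply_le f (star a * a)
  rw [← h, CStarRing.norm_star_mul_self, CStarRing.norm_star_mul_self] at h2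
  exact abs_le_of_sq_le_sq' (by simpa [sq] using h2) (norm_nonneg _) |>.2

theorem norm_matEmb_le (hS : IsCuntzSemigroupOf A S) {n : ℕ} (M : Matrix (Fin n) (Fin n) A) :
    ‖hS.matEmb n M‖ ≤ ∑ i, ∑ j, ‖M i j‖ := by
  conv_lhs => rw [Matrix.matrix_eq_sum_single M, map_sum]
  refine norm_sum_le_of_le _ fun i _ => ?_
  rw [map_sum]
  exact norm_sum_le_of_le _ fun j _ => hS.norm_matEmb_single_le i j _

theorem exists_matEmb_near (hS : IsCuntzSemigroupOf A S) {p : Prop} {d : hS.stab}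
    (hd : p → IsSelfAdjoint d) {δ : ℝ} (hδ : 0 < δ) :
    ∃ (n : ℕ) (a : Matrix (Fin n) (Fin n) A), (p → IsSelfAdjoint a) ∧
      ‖hS.matEmb n a - d‖ < δ := by
  obtain ⟨_, hx, hdx⟩ := hS.matEmb_dense.exists_dist_lt d hδ
  obtain ⟨n, a, rfl⟩ := Set.mem_iUnion.1 hx
  rw [dist_comm, dist_eq_norm] at hdx
  by_cases hp : p
  · refine ⟨n, (2⁻¹ : ℝ) • (a + star a),
      fun _ => IsSelfAdjoint.smul (.all _) (IsSelfAdjoint.add_star_self a), ?_⟩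
    have e : hS.matEmb n ((2⁻¹ : ℝ) • (a + star a)) - d =
        (2⁻¹ : ℝ) • ((hS.matEmb n a - d) + star (hS.matEmb n a - d)) := by
      have h1 : hS.matEmb n ((2⁻¹ : ℝ) • (a + star a)) =
          (2⁻¹ : ℝ) • hS.matEmb n (a + star a) := by
        rw [← Complex.coe_smul, map_smul, Complex.coe_smul]
      rw [h1, map_add, map_star, star_sub, (hd hp).star_eq]
      module
    rw [e, norm_smul, Real.norm_of_nonneg (by positivity)]
    have := norm_add_le (hS.matEmb n a - d) (star (hS.matEmb n a - d))
    rw [norm_star] at this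
    linarith
  · exact ⟨n, a, fun h => (hp h).elim, hdx⟩

theorem exists_isUnit_near (hS : IsCuntzSemigroupOf A S) {p : Prop}
    (h : ∀ x : Unitization ℂ A, (p → IsSelfAdjoint x) →
      x ∈ closure {y | (p → IsSelfAdjoint y) ∧ IsUnit y})
    {D : Unitization ℂ hS.stab} (FD : D.fst = 1) (hD : p → IsSelfAdjoint D) {δ : ℝ} (hδ : 0 < δ) :
    ∃ T : Unitization ℂ hS.stab, IsUnit T ∧ (p → IsSelfAdjoint T) ∧ T.fst = 1 ∧ ‖T - D‖ < δ := by
  have eD : D = 1 + (D.snd : Unitization ℂ hS.stab) := Unitization.ext (by simp [FD]) (by simp)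
  obtain ⟨n, a, sa, ha⟩ := hS.exists_matEmb_near (p := p) (d := D.snd)
    (fun hp => congrArg (fun z : Unitization ℂ hS.stab => z.snd) (hD hp)) (half_pos hδ)
  obtain ⟨T, ⟨⟨T, N, hTN, hNT⟩, rfl⟩, sT, FT, hTa⟩ := MatrixUnitsDense.of_dense
    (F := unitizationFst A) h n (1 + a.map (fun x => (x : Unitization ℂ A)))
    (by ext i j; simp [unitizationFst_apply, Matrix.one_apply, apply_ite])
    (fun hp => (IsSelfAdjoint.one _).add (by
      ext1 i j
      rw [Matrix.star_apply, Matrix.map_apply, Matrix.map_apply, ← Unitization.inr_star]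
      exact congrArg _ (congr_fun₂ (sa hp) i j)))
    (δ / (2 * (n * n + 1))) (by positivity)
  dsimp only at sT FT hTa
  have FN : N.map (unitizationFst A) = 1 := by
    have := MatrixUnitsDense.map_mul_eq (unitizationFst A) T N
    rwa [hTN, FT, one_mul, Matrix.map_one _ (map_zero _) (map_one _), eq_comm] at this
  have coe (M : Matrix (Fin n) (Fin n) (Unitization ℂ A)) (FM : M.map (unitizationFst A) = 1) :
      M = 1 + (M.map fun x => x.snd).map (fun x => (x : Unitization ℂ A)) := by
    ext i j
    · simpa [unitizationFst_apply, Matrix.one_apply, apply_ite] using congr_fun₂ FM i j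
    · simp [Matrix.one_apply, apply_ite]
  have mulcoe (β ν : Matrix (Fin n) (Fin n) A)
      (h : (1 + β.map (fun x => (x : Unitization ℂ A))) *
        (1 + ν.map (fun x => (x : Unitization ℂ A))) = 1) :
      (1 + (hS.matEmb n β : Unitization ℂ hS.stab)) *
        (1 + (hS.matEmb n ν : Unitization ℂ hS.stab)) = 1 := by
    have h1 : β + ν + β * ν = 0 := by
      have h2 : (β + ν + β * ν).map (fun x => (x : Unitization ℂ A)) = 0 := by
        have e : (β * ν).map (fun x => (x : Unitization ℂ A)) =
            β.map (fun x => (x : Unitization ℂ A)) * ν.map (fun x => (x : Unitization ℂ A)) := by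
          ext1 i j
          simp only [Matrix.map_apply, Matrix.mul_apply, ← Unitization.inr_mul]
          exact map_sum (Unitization.inrNonUnitalAlgHom ℂ A) _ _
        rw [Matrix.map_add _ (Unitization.inr_add ℂ), Matrix.map_add _ (Unitization.inr_add ℂ), e,
          ← sub_eq_zero.2 h]
        noncomm_ring
      ext i j
      exact Unitization.inr_injective (congr_fun₂ h2 i j)
    have h2 : hS.matEmb n β + hS.matEmb n ν + hS.matEmb n β * hS.matEmb n ν = 0 := by
      rw [← map_add, ← map_mul, ← map_add, h1, map_zero]
    calc _ = 1 + ((hS.matEmb n β + hS.matEmb n ν + hS.matEmb n β * hS.matEmb n ν : hS.stab) :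
          Unitization ℂ hS.stab) := by
          rw [Unitization.inr_add, Unitization.inr_add, Unitization.inr_mul]
          noncomm_ring
      _ = 1 := by rw [h2, Unitization.inr_zero, add_zero]
  set β := T.map fun x => x.snd with hβ
  set ν := N.map fun x => x.snd with hν
  have eT := coe T FT
  have eN := coe N FN
  refine ⟨1 + (hS.matEmb n β : Unitization ℂ hS.stab),
    isUnit_iff_exists.2 ⟨1 + (hS.matEmb n ν : Unitization ℂ hS.stab), mulcoe β ν ?_,
      mulcoe ν β ?_⟩, fun hp => (IsSelfAdjoint.one _).add ?_, by simp, ?_⟩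
  · rw [← eT, ← eN, hTN]
  · rw [← eT, ← eN, hNT]
  · have sβ : IsSelfAdjoint β := by
      ext i j
      exact congrArg (fun z => z.snd) (congr_fun₂ (sT hp) i j)
    rw [IsSelfAdjoint, ← Unitization.inr_star, ← map_star, sβ.star_eq]
  · have hle : ‖hS.matEmb n (β - a)‖ ≤ δ / 2 := by
      refine (hS.norm_matEmb_le _).trans ?_
      have hij (i j : Fin n) : ‖(β - a) i j‖ ≤ δ / (2 * (n * n + 1)) := by
        refine le_of_eq_of_le ?_ (hTa i j).le
        rw [← Unitization.norm_inr (𝕜 := ℂ), eT]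
        simp [hβ]
      calc ∑ i, ∑ j, ‖(β - a) i j‖ ≤ ∑ i : Fin n, ∑ j : Fin n, δ / (2 * (n * n + 1)) :=
            Finset.sum_le_sum fun i _ => Finset.sum_le_sum fun j _ => hij i j
        _ = (n * n) * δ / (2 * (n * n + 1)) := by simp; ring
        _ ≤ δ / 2 := by
          rw [div_le_div_iff₀ (by positivity) two_pos]
          nlinarith
    have e : 1 + (hS.matEmb n β : Unitization ℂ hS.stab) - D =
        ((hS.matEmb n (β - a) + (hS.matEmb n a - D.snd) : hS.stab) : Unitization ℂ hS.stab) := by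
      rw [map_sub, sub_add_sub_cancel, Unitization.inr_sub]
      nth_rw 1 [eD]
      abel
    rw [e, Unitization.norm_inr]
    exact (norm_add_le _ _).trans_lt (by linarith)

end IsCuntzSemigroupOf

end Stabilization

/-- Corollary 3.11.  For a C*-algebra of stable rank one or of real
rank zero, every element of `Cu(A)` has finite weak divisibility if and only if every
element has finite divisibility. -/
theorem wdiv_finite_iff_div_finite_of_sr1_or_rr0
    (A : Type) [NonUnitalCStarAlgebra A] (S : Type) [CuSemigroup S]
    (hS : IsCuntzSemigroupOf A S)
    (hyp : StableRankOne A ∨ RealRankZero A) :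
    (∀ x : S, ∃ m : ℕ, 1 ≤ m ∧ CuDiv.wdiv (2 * m) x < ⊤) ↔
      (∀ x : S, ∃ m : ℕ, 1 ≤ m ∧ CuDiv.Div (2 * m) x < ⊤) := by
  have hm := hS.cuModel
  refine wdiv_lt_top_iff_div_lt_top hm.addContinuous (hyp.imp (fun h => ?_) fun h => ?_)
  · have hd : UnitsDense (unitizationFst hS.stab) := fun D FD δ hδ => by
      obtain ⟨T, hT, -, -, hTD⟩ := hS.exists_isUnit_near (p := False)
        (fun x _ => by simpa using h x) FD False.elim hδ
      exact ⟨T, hT, hTD⟩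
    exact ⟨hm.almostCancellative hd, hm.almostInterpolation hd⟩
  · have hd : SelfAdjointUnitsDense (unitizationFst hS.stab) := fun D FD sD δ hδ => by
      obtain ⟨T, hT, sT, FT, hTD⟩ := hS.exists_isUnit_near (p := True)
        (fun x hx => by simpa using h x (hx trivial)) FD (fun _ => sD) hδ
      exact ⟨T, hT, sT trivial, FT, hTD⟩
    exact ⟨hm.compactsDense hd, hm.halvesRemainders⟩
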